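/- arXiv:2012.05121 — 4 statements merged into one kernel-verified Lean document; each statement's English description precedes it below -/
import Mathlib

section
/- Let p > 3 be a prime and let n be a positive integer. Then the rational number (T_{pn} − T_n)/(pn)^2 is a p-adic integer, and in ℤ_p it satisfies the congruence (T_{pn} − T_n)/(pn)^2 ≡ (T_{n−1}/6) · (p/3) · B_{p−2}(1/3) (mod p), i.e., the p-adic valuation of (T_{pn} − T_n)/(pn)^2 − (T_{n−1}/6)(p/3)B_{p−2}(1/3) is at least 1. -/
/-- The central trinomial coefficient: the coefficient of `x^n` in `(x^2+x+1)^n`. -/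
def centralTrinomial (n : ℕ) : ℕ :=
  ∑ k ∈ Finset.range (n / 2 + 1), Nat.choose n (2 * k) * Nat.choose (2 * k) k


namespace TrinProof

open Polynomial Finset

/-- The product of the `X + j` for `1 ≤ j ≤ p - 1`. -/
noncomputable def ff (p : ℕ) : ℤ[X] := ∏ j ∈ range (p - 1), (X + C ((j : ℤ) + 1))

/-- The product of `k` shifted copies of `ff p`. -/
noncomputable def KK (p k : ℕ) : ℤ[X] := ∏ i ∈ range k, (ff p).comp (X + C ((p : ℤ) * i))

lemma ff_eval (p : ℕ) (x : ℤ) : (ff p).eval x = ∏ j ∈ range (p - 1), (x + ((j : ℤ) + 1)) := by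
  simp [ff, eval_prod]

lemma KK_eval (p k : ℕ) (y : ℤ) :
    (KK p k).eval y = ∏ i ∈ range k, (ff p).eval (y + (p : ℤ) * i) := by
  simp [KK, eval_prod]

lemma ff_symm (p : ℕ) (hp : p.Prime) (hp3 : 3 < p) (x : ℤ) :
    (ff p).eval (-p - x) = (ff p).eval x := by
  have hodd : Even (p - 1) := hp.even_sub_one (by omega)
  rw [ff_eval, ff_eval, ← prod_range_reflect]
  have h : ∀ j ∈ range (p - 1), ((-p : ℤ) - x + (((p - 1 - 1 - j : ℕ) : ℤ) + 1))
      = (-1) * (x + ((j : ℤ) + 1)) := by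
    intro j hj
    have := mem_range.1 hj
    rw [Nat.cast_sub (by omega), Nat.cast_sub (by omega), Nat.cast_sub (by omega)]
    push_cast
    ring
  rw [prod_congr rfl h, prod_mul_distrib]
  simp [hodd.neg_one_pow]

lemma KK_symm (p : ℕ) (hp : p.Prime) (hp3 : 3 < p) (k : ℕ) :
    (KK p k).eval (-(p * k : ℤ)) = (KK p k).eval 0 := by
  rw [KK_eval, KK_eval, ← prod_range_reflect]
  refine prod_congr rfl fun i hi => ?_
  have := mem_range.1 hi
  rw [← ff_symm p hp hp3]
  congr 1
  rw [Nat.cast_sub (by omega), Nat.cast_sub (by omega)]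
  push_cast
  ring

lemma ff_map (p : ℕ) [hp : Fact p.Prime] :
    (ff p).map (Int.castRingHom (ZMod p)) = X ^ (p - 1) - 1 := by
  have h1 : (X : (ZMod p)[X]) * (ff p).map (Int.castRingHom (ZMod p)) = X ^ p - X := by
    have h2 : (∏ a : ZMod p, (X - C a)) = (X ^ p - X : (ZMod p)[X]) := by
      have hr := FiniteField.roots_X_pow_card_sub_X (ZMod p)
      have hd := FiniteField.X_pow_card_sub_X_natDegree_eq (ZMod p) hp.out.one_lt
      rw [ZMod.card] at hr
      have hm : (X ^ p - X : (ZMod p)[X]).Monic := by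
        apply monic_X_pow_sub
        rw [degree_X]
        exact_mod_cast hp.out.one_lt
      have := Polynomial.prod_multiset_X_sub_C_of_monic_of_roots_card_eq hm (by
        rw [hr, hd]; simp [ZMod.card])
      rw [hr] at this
      exact this
    have h3 : (∏ a : ZMod p, (X - C a)) = ∏ j ∈ range p, (X + C ((j : ZMod p))) := by
      have hneg : (∏ a : ZMod p, (X - C a)) = ∏ a : ZMod p, (X + C a) := by
        refine Fintype.prod_equiv (Equiv.neg _) _ _ fun a => ?_
        simp [sub_eq_add_neg]
      rw [hneg]
      symm
      refine prod_bij (fun j _ => (j : ZMod p)) (by simp) ?_ ?_ (by simp)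
      · intro a ha b hb hab
        rw [ZMod.natCast_eq_natCast_iff'] at hab
        rwa [Nat.mod_eq_of_lt (mem_range.1 ha), Nat.mod_eq_of_lt (mem_range.1 hb)] at hab
      · intro b _
        exact ⟨b.val, mem_range.2 (ZMod.val_lt b), by simp⟩
    have h4 : p = (p - 1) + 1 := (Nat.sub_add_cancel hp.out.one_lt.le).symm
    rw [← h2, h3]
    rw [show range p = range (p - 1 + 1) by rw [← h4]]
    rw [prod_range_succ', mul_comm]
    simp [ff, Polynomial.map_prod]
  have h5 : (X : (ZMod p)[X]) * (X ^ (p - 1) - 1) = X ^ p - X := by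
    rw [mul_sub, mul_one, ← pow_succ', Nat.sub_add_cancel hp.out.one_lt.le]
  exact mul_left_cancel₀ X_ne_zero (h1.trans h5.symm)

lemma KK_coeff_two (p : ℕ) [hp : Fact p.Prime] (hp3 : 3 < p) (k : ℕ) :
    (p : ℤ) ∣ (KK p k).coeff 2 := by
  rw [← ZMod.intCast_zmod_eq_zero_iff_dvd]
  have h1 : (KK p k).map (Int.castRingHom (ZMod p)) = (X ^ (p - 1) - 1) ^ k := by
    simp [KK, Polynomial.map_prod, Polynomial.map_comp, ff_map]
  have h2 : (((KK p k).coeff 2 : ℤ) : ZMod p) =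
      ((KK p k).map (Int.castRingHom (ZMod p))).coeff 2 := by
    rw [coeff_map]; rfl
  rw [h2, h1]
  have h3 : (X : (ZMod p)[X]) ^ 3 ∣ (X ^ (p - 1) - 1) ^ k - (C (-1)) ^ k := by
    refine dvd_trans ?_ (sub_dvd_pow_sub_pow _ _ k)
    have : (X ^ (p - 1) - 1 - C (-1) : (ZMod p)[X]) = X ^ (p - 1) := by simp
    rw [this]
    exact pow_dvd_pow _ (by omega)
  have h4 := (X_pow_dvd_iff.1 h3) 2 (by norm_num)
  rw [coeff_sub, ← C_pow, coeff_C] at h4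
  simpa using h4

lemma KK_diff (p : ℕ) [hp : Fact p.Prime] (hp3 : 3 < p) (k d : ℕ) :
    ∃ z : ℤ, (KK p k).eval (p * d : ℤ) - (KK p k).eval 0 = p ^ 3 * d * (d + k) * z := by
  rcases Nat.eq_zero_or_pos k with rfl | hk
  · exact ⟨0, by simp [KK]⟩
  obtain ⟨M, hM⟩ : (X : ℤ[X]) ∣ KK p k - C ((KK p k).eval 0) := by
    rw [X_dvd_iff]; simp [coeff_zero_eq_eval_zero]
  have hM2 : M.eval (-(p * k : ℤ)) = 0 := by
    have := congrArg (Polynomial.eval (-(p * k : ℤ))) hM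
    rw [eval_sub, KK_symm p hp.out hp3, eval_C, sub_self, eval_mul, eval_X] at this
    have h0 : (-(p * k : ℤ)) ≠ 0 := by
      have := hp.out.pos
      rw [neg_ne_zero]
      positivity
    exact (mul_eq_zero.1 this.symm).resolve_left h0
  obtain ⟨Q, hQ⟩ := dvd_iff_isRoot.2 hM2
  have h0 : (p : ℤ) ∣ Q.eval 0 := by
    have := congrArg (fun q => Polynomial.coeff q 2) hM
    simp only [coeff_sub, coeff_X_mul, coeff_C] at this
    rw [hQ, sub_mul, coeff_sub, coeff_X_mul, coeff_C_mul] at this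
    obtain ⟨c, hc⟩ := KK_coeff_two p hp3 k
    rw [hc] at this
    rw [← coeff_zero_eq_eval_zero]
    refine ⟨c - k * Q.coeff 1, ?_⟩
    simp at this
    linear_combination -this
  have h1 : (p : ℤ) ∣ Q.eval (p * d : ℤ) := by
    have := Polynomial.sub_dvd_eval_sub (p * d : ℤ) 0 Q
    have h2 : (p : ℤ) ∣ Q.eval (p * d : ℤ) - Q.eval 0 := by
      refine dvd_trans ?_ this
      simp
    simpa using dvd_add h2 h0
  obtain ⟨z, hz⟩ := h1
  refine ⟨z, ?_⟩
  have := congrArg (Polynomial.eval (p * d : ℤ)) hM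
  rw [hQ] at this
  simp only [eval_sub, eval_C, eval_mul, eval_X, hz] at this
  rw [this]
  ring

lemma fact_eq (p : ℕ) (hp : 0 < p) (n : ℕ) :
    ((p * n).factorial : ℤ) = p ^ n * n.factorial * (KK p n).eval 0 := by
  induction n with
  | zero => simp [KK]
  | succ n ih =>
    have h1 : ((p * n + p).factorial : ℤ) = (p * n).factorial * ((ff p).eval (p * n : ℤ) * (p * (n + 1))) := by
      rw [← Nat.factorial_mul_ascFactorial, Nat.ascFactorial_eq_prod_range]
      have h4 : p = (p - 1) + 1 := (Nat.sub_add_cancel hp).symm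
      conv_lhs => rw [show range p = range (p - 1 + 1) by rw [← h4]]
      rw [prod_range_succ, ff_eval]
      push_cast [Nat.cast_sub hp]
      congr 1
      congr 1
      · refine prod_congr rfl fun j _ => by ring
      · ring
    rw [mul_add, mul_one, h1, ih, KK_eval, KK_eval, prod_range_succ, Nat.factorial_succ]
    push_cast
    simp only [zero_add]
    ring

lemma choose_KK (p : ℕ) (hp : 0 < p) (k d : ℕ) :
    ((p * (d + k)).choose (p * k) : ℤ) * (KK p k).eval 0 =
      (d + k).choose k * (KK p k).eval (p * d : ℤ) := by
  have hF : (KK p (d + k)).eval 0 = (KK p d).eval 0 * (KK p k).eval (p * d : ℤ) := by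
    rw [KK_eval, KK_eval, KK_eval, prod_range_add]
    congr 1
    refine prod_congr rfl fun i _ => ?_
    congr 1
    push_cast
    ring
  have e1 : ((d + k).choose k : ℤ) * k.factorial * d.factorial = (d + k).factorial := by
    have := Nat.choose_mul_factorial_mul_factorial (Nat.le_add_left k d)
    rw [Nat.add_sub_cancel] at this
    exact_mod_cast this
  have e2 : ((p * (d + k)).choose (p * k) : ℤ) * (p * k).factorial * (p * d).factorial
      = (p * (d + k)).factorial := by
    have := Nat.choose_mul_factorial_mul_factorial (show p * k ≤ p * (d + k) by gcongr; omega)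
    rw [← Nat.mul_sub, Nat.add_sub_cancel] at this
    exact_mod_cast this
  rw [fact_eq p hp, fact_eq p hp, fact_eq p hp, hF, ← e1] at e2
  have hd : (KK p d).eval 0 ≠ 0 := by
    have := fact_eq p hp d
    intro h
    rw [h, mul_zero] at this
    exact (Nat.factorial_ne_zero _) (by exact_mod_cast this)
  have hne : ((p : ℤ) ^ (d + k) * k.factorial * d.factorial * (KK p d).eval 0) ≠ 0 := by
    have h1 := Nat.factorial_ne_zero k
    have h2 := Nat.factorial_ne_zero d
    refine mul_ne_zero (mul_ne_zero (mul_ne_zero (pow_ne_zero _ ?_) ?_) ?_) hd <;>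
      exact_mod_cast (by omega)
  apply mul_left_cancel₀ hne
  rw [pow_add] at *
  linear_combination e2

lemma KK_zero_not_dvd (p : ℕ) [hp : Fact p.Prime] (k : ℕ) : ¬ (p : ℤ) ∣ (KK p k).eval 0 := by
  have hpI : Prime (p : ℤ) := Nat.prime_iff_prime_int.1 hp.out
  rw [KK_eval]
  rw [hpI.dvd_finsetProd_iff]
  rintro ⟨i, _, hi⟩
  rw [ff_eval, hpI.dvd_finsetProd_iff] at hi
  obtain ⟨j, hj, hd⟩ := hi
  have : (p : ℤ) ∣ (j : ℤ) + 1 := by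
    have h := dvd_sub hd (Dvd.intro (i : ℤ) rfl : (p : ℤ) ∣ p * i)
    simpa using h
  have h2 := Nat.le_of_dvd (by omega) (by exact_mod_cast this : p ∣ j + 1)
  have := mem_range.1 hj
  omega

/-- The Jacobsthal-type congruence. -/
lemma jac (p : ℕ) [hp : Fact p.Prime] (hp3 : 3 < p) (k d : ℕ) :
    ∃ D z : ℤ, ¬ (p : ℤ) ∣ D ∧
      D * (((p * (d + k)).choose (p * k) : ℤ) - (d + k).choose k) =
        p ^ 3 * d * (d + k) * (d + k).choose k * z := by
  obtain ⟨z, hz⟩ := KK_diff p hp3 k d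
  refine ⟨(KK p k).eval 0, z, KK_zero_not_dvd p k, ?_⟩
  linear_combination choose_KK p hp.out.pos k d + ((d + k).choose k : ℤ) * hz

/-- First consequence: difference of binomials modulo `p ^ 3 * n ^ 2`. -/
lemma jac1 (p : ℕ) [hp : Fact p.Prime] (hp3 : 3 < p) (n k : ℕ) (hk : k < n) :
    ∃ D z : ℤ, ¬ (p : ℤ) ∣ D ∧
      D * (((p * n).choose (p * k) : ℤ) - n.choose k) = p ^ 3 * n ^ 2 * z := by
  obtain ⟨d, rfl⟩ : ∃ d, n = d + 1 + k := ⟨n - k - 1, by omega⟩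
  obtain ⟨D, z, hD, h⟩ := jac p hp3 k (d + 1)
  refine ⟨D, (d + k).choose k * z, hD, ?_⟩
  rw [h]
  have h2 := Nat.choose_mul_succ_eq (d + k) k
  rw [show d + k + 1 = d + 1 + k by ring, show d + 1 + k - k = d + 1 by omega] at h2
  have h3 : ((d + k).choose k : ℤ) * (d + 1 + k) = (d + 1 + k).choose k * (d + 1) := by
    exact_mod_cast h2
  push_cast
  linear_combination -(p ^ 3 * (d + 1 + k) * z) * h3

/-- Second consequence. -/
lemma jac2 (p : ℕ) [hp : Fact p.Prime] (hp3 : 3 < p) (n m : ℕ) (hn : 0 < n) (hm : 0 < m) :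
    ∃ D z : ℤ, ¬ (p : ℤ) ∣ D ∧
      D * (((p * m - 1).choose (p * n - 1) : ℤ) - (m - 1).choose (n - 1)) = p ^ 3 * n ^ 2 * z := by
  have hp0 := hp.out.pos
  rcases lt_or_ge m n with hmn | hmn
  · refine ⟨1, 0, ?_, ?_⟩
    · have hpI : Prime (p : ℤ) := Nat.prime_iff_prime_int.1 hp.out
      exact hpI.not_dvd_one
    · have h1 : p * m < p * n := by gcongr
      have h2 : 0 < p * m := by positivity
      rw [Nat.choose_eq_zero_of_lt (by omega), Nat.choose_eq_zero_of_lt (by omega)]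
      simp
  obtain ⟨k, rfl⟩ : ∃ k, m = n + k := ⟨m - n, by omega⟩
  obtain ⟨D, z, hD, h⟩ := jac p hp3 k n
  refine ⟨D, (n + k).choose k * z, hD, ?_⟩
  have s1 : (n + k).choose k = (n + k).choose n := by
    rw [Nat.choose_symm_add]
  have s2 : (p * (n + k)).choose (p * k) = (p * (n + k)).choose (p * n) := by
    rw [mul_add, Nat.choose_symm_add]
  rw [s1, s2] at h
  rw [s1]
  have pas : ∀ M N : ℕ, 0 < M → 0 < N → M * (M - 1).choose (N - 1) = M.choose N * N := by
    intro M N h1 h2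
    have := Nat.add_one_mul_choose_eq (M - 1) (N - 1)
    rwa [Nat.sub_add_cancel h1, Nat.sub_add_cancel h2] at this
  have e1 := pas (n + k) n hm hn
  have e2 := pas (p * (n + k)) (p * n) (by positivity) (by positivity)
  have e1' : ((n : ℤ) + k) * (n + k - 1).choose (n - 1) = (n + k).choose n * n := by
    exact_mod_cast e1
  have e2' : ((p : ℤ) * (n + k)) * (p * (n + k) - 1).choose (p * n - 1)
      = (p * (n + k)).choose (p * n) * (p * n) := by exact_mod_cast e2
  have hne : ((p : ℤ) * (n + k)) ≠ 0 := by positivity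
  apply mul_left_cancel₀ hne
  linear_combination D * e2' - D * p * e1' + p * n * h

end TrinProof
namespace TrinProof

open Finset

lemma tri1 (n : ℕ) : PowerSeries.coeff n ((1 + PowerSeries.X ^ 2 + PowerSeries.X : PowerSeries ℤ) ^ n)
    = centralTrinomial n := by
  have hc : ∀ m : ℕ, PowerSeries.coeff m ((1 + PowerSeries.X ^ 2 : PowerSeries ℤ) ^ m)
      = ∑ k ∈ range (m + 1), if m = 2 * k then (m.choose k : ℤ) else 0 := by
    intro m
    rw [add_comm, add_pow, map_sum]
    refine sum_congr rfl fun k _ => ?_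
    rw [one_pow, mul_one, ← pow_mul, ← map_natCast (PowerSeries.C (R := ℤ)), PowerSeries.coeff_mul_C,
      PowerSeries.coeff_X_pow]
    split_ifs <;> simp
  rw [add_pow, map_sum]
  have h1 : ∀ m ∈ range (n + 1), PowerSeries.coeff n ((1 + PowerSeries.X ^ 2 : PowerSeries ℤ) ^ m
      * PowerSeries.X ^ (n - m) * (n.choose m : PowerSeries ℤ)) =
      ∑ k ∈ range (n / 2 + 1), if m = 2 * k then (n.choose m * m.choose k : ℤ) else 0 := by
    intro m hm
    have hm' := mem_range.1 hm
    rw [← map_natCast (PowerSeries.C (R := ℤ)), PowerSeries.coeff_mul_C, PowerSeries.coeff_mul_X_pow',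
      if_pos (by omega), show n - (n - m) = m by omega, hc, sum_mul]
    have hx : ∀ (s : ℕ), (∀ k, m = 2 * k → k < s) → 
        ∑ k ∈ range s, (if m = 2 * k then (n.choose m * m.choose k : ℤ) else 0) =
        if 2 ∣ m then (n.choose m * m.choose (m / 2) : ℤ) else 0 := by
      intro s hs
      split_ifs with h
      · obtain ⟨q, rfl⟩ := h
        rw [sum_eq_single q]
        · simp
        · intro b _ hb
          rw [if_neg (by omega)]
        · intro hq
          exact absurd (mem_range.2 (hs q rfl)) hq
      · apply sum_eq_zero
        intro k _
        rw [if_neg]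
        rintro rfl
        exact h (dvd_mul_right _ _)
    rw [hx _ (by intro k hk; omega)]
    rw [← hx (m + 1) (by intro k hk; omega)]
    refine sum_congr rfl fun k _ => ?_
    split_ifs
    · simp [mul_comm]
    · simp
  rw [sum_congr rfl h1, sum_comm, centralTrinomial]
  push_cast
  refine sum_congr rfl fun k hk => ?_
  have := mem_range.1 hk
  rw [sum_ite_eq']
  rw [if_pos (mem_range.2 (by omega))]

lemma tri2 (n : ℕ) (hn : 0 < n) :
    (centralTrinomial n : ℤ) =
      ∑ a ∈ range n, (-1) ^ a * ((n.choose a : ℤ) * ((2 * n - 3 * a - 1).choose (n - 1) : ℤ)) := by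
  rw [← tri1]
  have h0 : (1 + PowerSeries.X ^ 2 + PowerSeries.X : PowerSeries ℤ) ^ n =
      (-PowerSeries.X ^ 3 + 1) ^ n * (PowerSeries.invOneSubPow ℤ n).val := by
    have h1 : (1 - PowerSeries.X : PowerSeries ℤ) ^ n * (PowerSeries.invOneSubPow ℤ n).val = 1 := by
      rw [← PowerSeries.invOneSubPow_inv_eq_one_sub_pow]
      exact (PowerSeries.invOneSubPow ℤ n).inv_val
    calc (1 + PowerSeries.X ^ 2 + PowerSeries.X : PowerSeries ℤ) ^ n
        = (1 + PowerSeries.X ^ 2 + PowerSeries.X : PowerSeries ℤ) ^ n *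
          ((1 - PowerSeries.X : PowerSeries ℤ) ^ n * (PowerSeries.invOneSubPow ℤ n).val) := by
            rw [h1, mul_one]
      _ = _ := by
        rw [← mul_assoc, ← mul_pow]
        congr 2
        ring
  rw [h0, PowerSeries.invOneSubPow_val_eq_mk_sub_one_add_choose_of_pos _ _ hn, add_pow, sum_mul, map_sum,
    sum_range_succ]
  have ht : ∀ a : ℕ, PowerSeries.coeff n ((-PowerSeries.X ^ 3) ^ a * 1 ^ (n - a) *
      (n.choose a : PowerSeries ℤ) * PowerSeries.mk fun m => ((n - 1 + m).choose (n - 1) : ℤ))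
      = if 3 * a ≤ n then (-1) ^ a * ((n.choose a : ℤ) * ((2 * n - 3 * a - 1).choose (n - 1) : ℤ)) else 0 := by
    intro a
    have e : ((-PowerSeries.X ^ 3) ^ a * 1 ^ (n - a) *
      (n.choose a : PowerSeries ℤ) * PowerSeries.mk fun m => ((n - 1 + m).choose (n - 1) : ℤ))
      = PowerSeries.C ((-1) ^ a * (n.choose a : ℤ)) * (PowerSeries.X ^ (3 * a) *
        PowerSeries.mk fun m => ((n - 1 + m).choose (n - 1) : ℤ)) := by
      rw [neg_pow, ← pow_mul]
      simp
      ring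
    rw [e, PowerSeries.coeff_C_mul, PowerSeries.coeff_X_pow_mul']
    split_ifs with h
    · rw [PowerSeries.coeff_mk, show n - 1 + (n - 3 * a) = 2 * n - 3 * a - 1 by omega]
      ring
    · simp
  rw [ht n, if_neg (by omega), add_zero]
  refine sum_congr rfl fun a ha => ?_
  have := mem_range.1 ha
  rw [ht]
  split_ifs with h
  · rfl
  · rw [Nat.choose_eq_zero_of_lt (by omega : 2 * n - 3 * a - 1 < n - 1)]
    simp

/-- The second-difference form of the trinomial formula. -/
lemma tri3 (n : ℕ) (hn : 0 < n) :
    (centralTrinomial (n - 1) : ℤ) =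
      ∑ a ∈ range n, (-1) ^ a * (((n - 1).choose a : ℤ) *
        (((2 * n - 3 * a - 1).choose n : ℤ) - 2 * (2 * n - 3 * a - 2).choose n
          + (2 * n - 3 * a - 3).choose n)) := by
  rcases Nat.lt_or_ge 1 n with h | h
  swap
  · obtain rfl : n = 1 := by omega
    simp [centralTrinomial]
  obtain ⟨k, rfl⟩ : ∃ k, n = k + 2 := ⟨n - 2, by omega⟩
  rw [show k + 2 - 1 = k + 1 by omega, sum_range_succ, tri2 (k + 1) (by omega)]
  rw [Nat.choose_eq_zero_of_lt (by omega : 2 * (k + 2) - 3 * (k + 1) - 1 < k + 2),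
    Nat.choose_eq_zero_of_lt (by omega : 2 * (k + 2) - 3 * (k + 1) - 2 < k + 2),
    Nat.choose_eq_zero_of_lt (by omega : 2 * (k + 2) - 3 * (k + 1) - 3 < k + 2)]
  simp only [Nat.cast_zero, mul_zero, sub_zero, add_zero]
  refine sum_congr rfl fun a ha => ?_
  have := mem_range.1 ha
  congr 2
  rw [show k + 1 - 1 = k by omega]
  rcases Nat.lt_or_ge (3 * a) (k + 2) with h3 | h3
  · obtain ⟨M, hM⟩ : ∃ M, 2 * (k + 2) - 3 * a = M + 3 := ⟨2 * (k + 2) - 3 * a - 3, by omega⟩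
    rw [hM, show 2 * (k + 1) - 3 * a - 1 = M by omega, show M + 3 - 1 = M + 2 by omega,
      show M + 3 - 2 = M + 1 by omega, show M + 3 - 3 = M by omega]
    rw [Nat.choose_succ_succ' (M + 1) (k + 1), Nat.choose_succ_succ' M (k + 1),
      Nat.choose_succ_succ' M k]
    push_cast
    ring
  · rw [Nat.choose_eq_zero_of_lt (by omega : 2 * (k + 2) - 3 * a - 1 < k + 2),
    Nat.choose_eq_zero_of_lt (by omega : 2 * (k + 2) - 3 * a - 2 < k + 2),
    Nat.choose_eq_zero_of_lt (by omega : 2 * (k + 2) - 3 * a - 3 < k + 2),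
    Nat.choose_eq_zero_of_lt (by omega : 2 * (k + 1) - 3 * a - 1 < k)]
    simp

end TrinProof
namespace TrinProof

open Finset

/-- `RR p x r`: the `p`-adic number `x` is integral with residue `r`. -/
def RR (p : ℕ) [hp : Fact p.Prime] (x : ℚ_[p]) (r : ZMod p) : Prop :=
  ∃ z : ℤ_[p], (z : ℚ_[p]) = x ∧ PadicInt.toZMod z = r

section calculus

variable {p : ℕ} [hp : Fact p.Prime]

lemma RR.add {x y : ℚ_[p]} {r s : ZMod p} (hx : RR p x r) (hy : RR p y s) :
    RR p (x + y) (r + s) := by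
  obtain ⟨z, rfl, rfl⟩ := hx
  obtain ⟨w, rfl, rfl⟩ := hy
  exact ⟨z + w, by simp, by simp⟩

lemma RR.mul {x y : ℚ_[p]} {r s : ZMod p} (hx : RR p x r) (hy : RR p y s) :
    RR p (x * y) (r * s) := by
  obtain ⟨z, rfl, rfl⟩ := hx
  obtain ⟨w, rfl, rfl⟩ := hy
  exact ⟨z * w, by simp, by simp⟩

lemma RR.neg {x : ℚ_[p]} {r : ZMod p} (hx : RR p x r) : RR p (-x) (-r) := by
  obtain ⟨z, rfl, rfl⟩ := hx
  exact ⟨-z, by simp, by simp⟩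

lemma RR.sub {x y : ℚ_[p]} {r s : ZMod p} (hx : RR p x r) (hy : RR p y s) :
    RR p (x - y) (r - s) := by
  obtain ⟨z, rfl, rfl⟩ := hx
  obtain ⟨w, rfl, rfl⟩ := hy
  exact ⟨z - w, by simp, by simp⟩

lemma RR.pow {x : ℚ_[p]} {r : ZMod p} (hx : RR p x r) (n : ℕ) : RR p (x ^ n) (r ^ n) := by
  obtain ⟨z, rfl, rfl⟩ := hx
  exact ⟨z ^ n, by simp, by simp⟩

lemma RR.int (m : ℤ) : RR p (m : ℚ_[p]) (m : ZMod p) := ⟨m, by simp, by simp⟩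

lemma RR.nat (m : ℕ) : RR p (m : ℚ_[p]) (m : ZMod p) := ⟨m, by simp, by simp⟩

lemma RR.sum {ι : Type*} (s : Finset ι) (f : ι → ℚ_[p]) (g : ι → ZMod p)
    (h : ∀ i ∈ s, RR p (f i) (g i)) : RR p (∑ i ∈ s, f i) (∑ i ∈ s, g i) := by
  classical
  induction s using Finset.induction_on with
  | empty => simpa using RR.int (p := p) 0
  | insert a s ha ih =>
    rw [sum_insert ha, sum_insert ha]
    exact (h a (mem_insert_self _ _)).add (ih fun i hi => h i (mem_insert_of_mem hi))

lemma RR.unique {x : ℚ_[p]} {r s : ZMod p} (hx : RR p x r) (hy : RR p x s) : r = s := by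
  obtain ⟨z, rfl, rfl⟩ := hx
  obtain ⟨w, h, rfl⟩ := hy
  rw [Subtype.ext h]

lemma RR.inv {x : ℚ_[p]} {r : ZMod p} (hx : RR p x r) (hr : r ≠ 0) : RR p x⁻¹ r⁻¹ := by
  obtain ⟨z, rfl, rfl⟩ := hx
  have hu : IsUnit z := by
    by_contra h
    apply hr
    have : z ∈ IsLocalRing.maximalIdeal ℤ_[p] := h
    rwa [← PadicInt.ker_toZMod, RingHom.mem_ker] at this
  obtain ⟨u, rfl⟩ := hu
  refine ⟨((u⁻¹ : ℤ_[p]ˣ) : ℤ_[p]), ?_, ?_⟩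
  · apply eq_inv_of_mul_eq_one_left
    rw [← PadicInt.coe_mul, Units.inv_mul, PadicInt.coe_one]
  · apply eq_inv_of_mul_eq_one_left
    rw [← map_mul, Units.inv_mul, map_one]

lemma RR.div {x y : ℚ_[p]} {r s : ZMod p} (hx : RR p x r) (hy : RR p y s) (hs : s ≠ 0) :
    RR p (x / y) (r / s) := by
  rw [div_eq_mul_inv, div_eq_mul_inv]
  exact hx.mul (hy.inv hs)

lemma RR.norm_le {x : ℚ_[p]} {r : ZMod p} (hx : RR p x r) : ‖x‖ ≤ 1 := by
  obtain ⟨z, rfl, rfl⟩ := hx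
  exact z.2

lemma RR.norm_le_inv {x : ℚ_[p]} (hx : RR p x 0) : ‖x‖ ≤ (p : ℝ)⁻¹ := by
  obtain ⟨z, rfl, h⟩ := hx
  rw [← RingHom.mem_ker, PadicInt.ker_toZMod, PadicInt.maximalIdeal_eq_span_p,
    Ideal.mem_span_singleton] at h
  obtain ⟨w, rfl⟩ := h
  rw [PadicInt.coe_mul, norm_mul]
  have h1 : ‖((p : ℤ_[p]) : ℚ_[p])‖ = (p : ℝ)⁻¹ := by simp
  rw [h1]
  have : ‖(w : ℚ_[p])‖ ≤ 1 := w.2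
  exact mul_le_of_le_one_right (by positivity) this

end calculus

lemma sum_blocks {M : Type*} [AddCommMonoid M] (p : ℕ) (hp : 0 < p) (n : ℕ) (g : ℕ → M) :
    ∑ j ∈ range (p * n), g j =
      ∑ a ∈ range n, (g (p * a) + ∑ b ∈ Ico 1 p, g (p * a + b)) := by
  induction n with
  | zero => simp
  | succ n ih =>
    rw [mul_add, mul_one, sum_range_add, ih, sum_range_succ]
    congr 1
    rw [sum_range_eq_add_Ico _ hp, add_zero]

section residues

variable (p : ℕ) [hp : Fact p.Prime]

lemma choose_pred (b : ℕ) (hb : b < p) : (((p - 1).choose b : ℕ) : ZMod p) = (-1) ^ b := by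
  induction b with
  | zero => simp
  | succ k ih =>
    have h1 := Nat.choose_succ_succ' (p - 1) k
    rw [Nat.sub_add_cancel hp.out.one_lt.le] at h1
    have h2 : ((p.choose (k + 1) : ℕ) : ZMod p) = 0 := by
      rw [ZMod.natCast_eq_zero_iff]
      exact hp.out.dvd_choose_self (by omega) hb
    rw [h1] at h2
    push_cast at h2
    rw [ih (by omega)] at h2
    rw [pow_succ]
    linear_combination h2

lemma lucas (m k : ℕ) : ((m.choose k : ℕ) : ZMod p) =
    ((m % p).choose (k % p) : ℕ) * ((m / p).choose (k / p) : ℕ) := by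
  have := Choose.choose_modEq_choose_mod_mul_choose_div_nat (n := m) (k := k) (p := p)
  rw [← ZMod.natCast_eq_natCast_iff] at this
  exact_mod_cast this

lemma luc1 (n a b : ℕ) (hn : 0 < n) (hb : 0 < b) (hbp : b < p) :
    (((p * n - 1).choose (p * a + b - 1) : ℕ) : ZMod p) = (-1) ^ (b - 1) * ((n - 1).choose a : ℕ) := by
  obtain ⟨n, rfl⟩ : ∃ k, n = k + 1 := ⟨n - 1, by omega⟩
  have e1 : p * (n + 1) - 1 = (p - 1) + p * n := by
    rw [mul_add, mul_one]; omega
  have e2 : p * a + b - 1 = (b - 1) + p * a := by omega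
  rw [lucas, e1, e2, Nat.add_mul_mod_self_left, Nat.add_mul_mod_self_left,
    Nat.add_mul_div_left _ _ hp.out.pos, Nat.add_mul_div_left _ _ hp.out.pos,
    Nat.mod_eq_of_lt (by omega), Nat.mod_eq_of_lt (by omega), Nat.div_eq_of_lt (by omega),
    Nat.div_eq_of_lt (by omega), zero_add, zero_add, choose_pred p _ (by omega)]
  simp

lemma luc2 (hp3 : 3 < p) (n a b : ℕ) (hb : 0 < b) (hbp : b < p) :
    (((2 * (p * n) - 3 * (p * a + b)).choose (p * n) : ℕ) : ZMod p) =
      ((2 * n - 3 * a - (3 * b / p + 1)).choose n : ℕ) := by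
  have hp0 := hp.out.pos
  have hnd : ¬ p ∣ 3 * b := by
    rw [hp.out.dvd_mul]
    rintro (h | h)
    · have := Nat.le_of_dvd (by omega) h; omega
    · have := Nat.le_of_dvd hb h; omega
  have hmod : 0 < 3 * b % p := Nat.pos_of_ne_zero fun h => hnd (Nat.dvd_of_mod_eq_zero h)
  have hdm := Nat.div_add_mod (3 * b) p
  have hml := Nat.mod_lt (3 * b) hp0
  have e : (2 * (p * n) - 3 * (p * a + b)) / p = 2 * n - 3 * a - (3 * b / p + 1) := by
    have e1 : 2 * (p * n) - 3 * (p * a + b) = p * (2 * n - 3 * a) - 3 * b := by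
      rw [Nat.mul_sub]
      have : 2 * (p * n) = p * (2 * n) := by ring
      have h2 : 3 * (p * a + b) = p * (3 * a) + 3 * b := by ring
      omega
    rw [e1]
    generalize 2 * n - 3 * a = M
    generalize hc : 3 * b / p = c at *
    rcases Nat.lt_or_ge c M with h | h
    · obtain ⟨d, rfl⟩ : ∃ d, M = c + 1 + d := ⟨M - (c + 1), by omega⟩
      rw [Nat.add_sub_cancel_left]
      have : p * (c + 1 + d) - 3 * b = (p - 3 * b % p) + p * d := by
        have : p * (c + 1 + d) = p * c + p + p * d := by ring
        omega
      rw [this, Nat.add_mul_div_left _ _ hp0, Nat.div_eq_of_lt (by omega), zero_add]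
    · have : p * M ≤ p * c := by gcongr
      rw [show p * M - 3 * b = 0 by omega, show M - (c + 1) = 0 by omega]
      simp
  rw [lucas, e]
  simp [Nat.mul_div_cancel_left _ hp0]

/-- Inverse square residues. -/
def ww (b : ℕ) : ZMod p := ((b : ZMod p) ^ 2)⁻¹

/-- The sum of inverse squares over the first third. -/
def S1 : ZMod p := ∑ b ∈ Ico 1 p, if 3 * b / p = 0 then ww p b else 0

lemma sum_ww (hp3 : 3 < p) : ∑ b ∈ Ico 1 p, ww p b = 0 := by
  have h1 : ∑ x : ZMod p, x ^ (p - 3) = 0 := by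
    apply FiniteField.sum_pow_lt_card_sub_one
    rw [ZMod.card]; omega
  have h2 : ∑ b ∈ range p, (b : ZMod p) ^ (p - 3) = ∑ x : ZMod p, x ^ (p - 3) := by
    refine sum_bij (fun j _ => (j : ZMod p)) (by simp) ?_ ?_ (by simp)
    · intro a ha b hb hab
      rw [ZMod.natCast_eq_natCast_iff'] at hab
      rwa [Nat.mod_eq_of_lt (mem_range.1 ha), Nat.mod_eq_of_lt (mem_range.1 hb)] at hab
    · intro b _
      exact ⟨b.val, mem_range.2 (ZMod.val_lt b), by simp⟩
  rw [h1, sum_range_eq_add_Ico _ (by omega)] at h2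
  rw [Nat.cast_zero, zero_pow (by omega), zero_add] at h2
  rw [← h2]
  refine sum_congr rfl fun b hb => ?_
  have hb' := mem_Ico.1 hb
  have hb0 : (b : ZMod p) ≠ 0 := by
    rw [Ne, ZMod.natCast_eq_zero_iff]
    intro h
    have := Nat.le_of_dvd (by omega) h
    omega
  rw [ww, inv_eq_iff_eq_inv]
  apply eq_inv_of_mul_eq_one_left
  rw [← pow_add, show 2 + (p - 3) = p - 1 by omega]
  exact ZMod.pow_card_sub_one_eq_one hb0

lemma ww_eq (b : ℕ) (hp3 : 3 < p) (hb0 : (b : ZMod p) ≠ 0) : ww p b = (b : ZMod p) ^ (p - 3) := by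
  rw [ww, inv_eq_iff_eq_inv]
  apply eq_inv_of_mul_eq_one_left
  rw [← pow_add, show 2 + (p - 3) = p - 1 by omega]
  exact ZMod.pow_card_sub_one_eq_one hb0

lemma div_refl (hp3 : 3 < p) (b : ℕ) (hb : 0 < b) (hbp : b < p) :
    3 * (p - b) / p = 2 - 3 * b / p ∧ 3 * b / p ≤ 2 := by
  have hp0 := hp.out.pos
  have hnd : ¬ p ∣ 3 * b := by
    rw [hp.out.dvd_mul]
    rintro (h | h)
    · have := Nat.le_of_dvd (by omega) h; omega
    · have := Nat.le_of_dvd hb h; omega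
  have hmod : 0 < 3 * b % p := Nat.pos_of_ne_zero fun h => hnd (Nat.dvd_of_mod_eq_zero h)
  have hdm := Nat.div_add_mod (3 * b) p
  have hml := Nat.mod_lt (3 * b) hp0
  have h2 : 3 * b / p < 3 := by
    rw [Nat.div_lt_iff_lt_mul hp0]; omega
  refine ⟨?_, by omega⟩
  generalize 3 * b / p = c at *
  have : 3 * (p - b) = (p - 3 * b % p) + p * (2 - c) := by
    interval_cases c <;> omega
  rw [this, Nat.add_mul_div_left _ _ hp0, Nat.div_eq_of_lt (by omega), zero_add]

lemma sum_third (hp3 : 3 < p) (h : ℕ → ZMod p) :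
    ∑ b ∈ Ico 1 p, h (3 * b / p + 1) * ww p b = S1 p * (h 1 - 2 * h 2 + h 3) := by
  have hS3 : (∑ b ∈ Ico 1 p, if 3 * b / p = 2 then ww p b else 0) = S1 p := by
    rw [S1]
    refine sum_bij' (fun b _ => p - b) (fun b _ => p - b) ?_ ?_ ?_ ?_ ?_
    · intro b hb; have := mem_Ico.1 hb; rw [mem_Ico]; omega
    · intro b hb; have := mem_Ico.1 hb; rw [mem_Ico]; omega
    · intro b hb; have := mem_Ico.1 hb; omega
    · intro b hb; have := mem_Ico.1 hb; omega
    · intro b hb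
      have hb' := mem_Ico.1 hb
      obtain ⟨h1, h2⟩ := div_refl p hp3 b (by omega) (by omega)
      have : ww p (p - b) = ww p b := by
        rw [ww, ww, Nat.cast_sub (by omega)]
        simp
      rw [h1, this]
      congr 1
      rw [eq_iff_iff]
      omega
  have hS2 : (∑ b ∈ Ico 1 p, if 3 * b / p = 1 then ww p b else 0) = - 2 * S1 p := by
    have : ∑ b ∈ Ico 1 p, ww p b = S1 p + (∑ b ∈ Ico 1 p, if 3 * b / p = 1 then ww p b else 0) +
        (∑ b ∈ Ico 1 p, if 3 * b / p = 2 then ww p b else 0) := by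
      rw [S1, ← sum_add_distrib, ← sum_add_distrib]
      refine sum_congr rfl fun b hb => ?_
      have hb' := mem_Ico.1 hb
      obtain ⟨h1, h2⟩ := div_refl p hp3 b (by omega) (by omega)
      generalize 3 * b / p = c at *
      interval_cases c <;> simp
    rw [sum_ww p hp3, hS3] at this
    linear_combination -this
  have : ∑ b ∈ Ico 1 p, h (3 * b / p + 1) * ww p b =
      h 1 * S1 p + h 2 * (∑ b ∈ Ico 1 p, if 3 * b / p = 1 then ww p b else 0) +
        h 3 * (∑ b ∈ Ico 1 p, if 3 * b / p = 2 then ww p b else 0) := by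
    rw [S1, mul_sum, mul_sum, mul_sum, ← sum_add_distrib, ← sum_add_distrib]
    refine sum_congr rfl fun b hb => ?_
    have hb' := mem_Ico.1 hb
    obtain ⟨h1, h2⟩ := div_refl p hp3 b (by omega) (by omega)
    generalize 3 * b / p = c at *
    interval_cases c <;> simp
  rw [this, hS2, hS3]
  ring

end residues

end TrinProof
namespace TrinProof

open Finset

/-- The summand of the trinomial formula. -/
def tt (n a : ℕ) : ℤ :=
  (-1) ^ a * ((n.choose a : ℤ) * ((2 * n - 3 * a - 1).choose (n - 1) : ℤ))

section main

variable (p : ℕ) [hp : Fact p.Prime]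

lemma jac2' (hp3 : 3 < p) (n a : ℕ) (ha : a < n) :
    ∃ D z : ℤ, ¬ (p : ℤ) ∣ D ∧
      D * (((2 * (p * n) - 3 * (p * a) - 1).choose (p * n - 1) : ℤ)
        - (2 * n - 3 * a - 1).choose (n - 1)) = p ^ 3 * n ^ 2 * z := by
  have e : 2 * (p * n) - 3 * (p * a) = p * (2 * n - 3 * a) := by
    rw [Nat.mul_sub]
    congr 1 <;> ring
  rw [e]
  rcases Nat.eq_zero_or_pos (2 * n - 3 * a) with h | h
  · rw [h]
    have h1 : p * 2 ≤ p * n := by gcongr; omega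
    refine ⟨1, 0, (Nat.prime_iff_prime_int.1 hp.out).not_dvd_one, ?_⟩
    rw [Nat.choose_eq_zero_of_lt (by omega), Nat.choose_eq_zero_of_lt (by omega)]
    simp
  · exact jac2 p hp3 n _ (by omega) h

lemma c0 (hp3 : 3 < p) (n a : ℕ) (ha : a < n) :
    RR p (((tt (p * n) (p * a) : ℚ_[p]) - (tt n a : ℚ_[p])) / (p * n : ℚ_[p]) ^ 2) 0 := by
  obtain ⟨D1, z1, hD1, h1⟩ := jac1 p hp3 n a ha
  obtain ⟨D2, z2, hD2, h2⟩ := jac2' p hp3 n a ha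
  have hodd : Odd p := hp.out.odd_of_ne_two (by omega)
  have hs : (-1 : ℤ) ^ (p * a) = (-1) ^ a := by rw [pow_mul, hodd.neg_one_pow]
  rw [tt, tt, hs]
  generalize ((p * n).choose (p * a) : ℤ) = x at *
  generalize (n.choose a : ℤ) = x' at *
  generalize ((2 * (p * n) - 3 * (p * a) - 1).choose (p * n - 1) : ℤ) = y at *
  generalize ((2 * n - 3 * a - 1).choose (n - 1) : ℤ) = y' at *
  have k1 : (D1 : ℚ_[p]) * (x - x') = p ^ 3 * n ^ 2 * z1 := by exact_mod_cast congrArg (Int.cast (R := ℚ_[p])) h1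
  have k2 : (D2 : ℚ_[p]) * (y - y') = p ^ 3 * n ^ 2 * z2 := by exact_mod_cast congrArg (Int.cast (R := ℚ_[p])) h2
  have hD1' : (D1 : ZMod p) ≠ 0 := by rwa [Ne, ZMod.intCast_zmod_eq_zero_iff_dvd]
  have hD2' : (D2 : ZMod p) ≠ 0 := by rwa [Ne, ZMod.intCast_zmod_eq_zero_iff_dvd]
  have hD1q : (D1 : ℚ_[p]) ≠ 0 := by
    intro h; apply hD1'; have : D1 = 0 := by exact_mod_cast h
    simp [this]
  have hD2q : (D2 : ℚ_[p]) ≠ 0 := by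
    intro h; apply hD2'; have : D2 = 0 := by exact_mod_cast h
    simp [this]
  have hpq : (p : ℚ_[p]) ≠ 0 := by exact_mod_cast hp.out.ne_zero
  have hnq : (n : ℚ_[p]) ≠ 0 := by exact_mod_cast (by omega : n ≠ 0)
  have e : (((((-1) ^ a * (x * y) : ℤ) : ℚ_[p]) - (((-1) ^ a * (x' * y') : ℤ) : ℚ_[p])) / (p * n : ℚ_[p]) ^ 2)
      = (((-1) ^ a : ℤ) : ℚ_[p]) * ((p : ℤ) : ℚ_[p]) *
        (((z1 * y : ℤ) : ℚ_[p]) / D1 + ((z2 * x' : ℤ) : ℚ_[p]) / D2) := by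
    rw [div_add_div _ _ hD1q hD2q, mul_div_assoc', div_eq_div_iff (by positivity) (by positivity)]
    push_cast
    linear_combination ((-1) ^ a * D2 * y) * k1 + ((-1) ^ a * D1 * x') * k2
  rw [e]
  have := ((RR.int (p := p) ((-1) ^ a)).mul (RR.int (p := p) (p : ℤ))).mul
    (((RR.int (p := p) (z1 * y)).div (RR.int D1) hD1').add ((RR.int (p := p) (z2 * x')).div (RR.int D2) hD2'))
  simpa using this

lemma c1 (hp3 : 3 < p) (n a b : ℕ) (hn : 0 < n) (hb : 0 < b) (hbp : b < p) :
    RR p ((tt (p * n) (p * a + b) : ℚ_[p]) / (p * n : ℚ_[p]) ^ 2)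
      ((-1) ^ a * ((n - 1).choose a : ℕ) / 3 *
        (((2 * n - 3 * a - (3 * b / p + 1)).choose n : ℕ) * ww p b)) := by
  have hp0 := hp.out.pos
  have hN : 0 < p * n := by positivity
  have pas : ∀ M N : ℕ, 0 < M → 0 < N → M * (M - 1).choose (N - 1) = M.choose N * N := by
    intro M N h1 h2
    have := Nat.add_one_mul_choose_eq (M - 1) (N - 1)
    rwa [Nat.sub_add_cancel h1, Nat.sub_add_cancel h2] at this
  have L1 := luc1 p n a b hn hb hbp
  have L2 := luc2 p hp3 n a b hb hbp
  have hodd : Odd p := hp.out.odd_of_ne_two (by omega)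
  have hs : (-1 : ZMod p) ^ (p * a + b) * (-1) ^ (b - 1) = -(-1) ^ a := by
    rw [pow_add, pow_mul, hodd.neg_one_pow, mul_assoc, ← pow_add]
    have : Odd (b + (b - 1)) := ⟨b - 1, by omega⟩
    rw [this.neg_one_pow]; ring
  have hb0 : (b : ZMod p) ≠ 0 := by
    rw [Ne, ZMod.natCast_eq_zero_iff]
    intro h
    have := Nat.le_of_dvd (by omega) h
    omega
  have h30 : (3 : ZMod p) ≠ 0 := by
    have : ((3 : ℕ) : ZMod p) ≠ 0 := by
      rw [Ne, ZMod.natCast_eq_zero_iff]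
      intro h
      have := Nat.le_of_dvd (by omega) h
      omega
    exact_mod_cast this
  have hjz : ((p * a + b : ℕ) : ZMod p) = b := by simp
  have hmz : ((2 * (p * n : ℕ) - 3 * (p * a + b : ℕ) : ℤ) : ZMod p) = -3 * b := by simp
  have hj0 : 0 < p * a + b := by omega
  have id1 := pas (p * n) (p * a + b) hN hj0
  have id2 : (2 * (p * n : ℕ) - 3 * (p * a + b : ℕ) : ℤ) *
      ((2 * (p * n) - 3 * (p * a + b) - 1).choose (p * n - 1) : ℕ) =
      (2 * (p * n) - 3 * (p * a + b)).choose (p * n) * ((p * n : ℕ) : ℤ) := by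
    rcases Nat.lt_or_ge (3 * (p * a + b)) (2 * (p * n)) with h | h
    · have := pas (2 * (p * n) - 3 * (p * a + b)) (p * n) (by omega) hN
      have hc : ((2 * (p * n) - 3 * (p * a + b) : ℕ) : ℤ) = 2 * (p * n : ℕ) - 3 * (p * a + b : ℕ) := by
        rw [Nat.cast_sub h.le]
        push_cast
        ring
      rw [← hc]
      exact_mod_cast this
    · have h1 : p * 1 ≤ p * n := by gcongr; omega
      rw [Nat.sub_eq_zero_of_le h, Nat.choose_eq_zero_of_lt (by omega),
        Nat.choose_eq_zero_of_lt (by omega)]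
      simp
  rw [tt]
  have hjq : ((p * a + b : ℕ) : ZMod p) ≠ 0 := by rwa [hjz]
  have hmq : ((2 * (p * n : ℕ) - 3 * (p * a + b : ℕ) : ℤ) : ZMod p) ≠ 0 := by
    rw [hmz]; exact mul_ne_zero (neg_ne_zero.2 h30) hb0
  have id1' : ((p * n : ℕ) : ℤ) * (p * n - 1).choose (p * a + b - 1) =
    (p * n).choose (p * a + b) * (p * a + b : ℕ) := by exact_mod_cast id1
  have key : RR p ((((-1) ^ (p * a + b) * (((p * n - 1).choose (p * a + b - 1) : ℕ) *
        ((2 * (p * n) - 3 * (p * a + b)).choose (p * n) : ℕ)) : ℤ) : ℚ_[p]) /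
        (((p * a + b : ℕ) * (2 * (p * n : ℕ) - 3 * (p * a + b : ℕ)) : ℤ) : ℚ_[p])) _ :=
    (RR.int _).div (RR.int _) (by rw [Int.cast_mul, Int.cast_natCast]; exact mul_ne_zero hjq hmq)
  convert key using 1
  · have hne : (((p * a + b : ℕ) * (2 * (p * n : ℕ) - 3 * (p * a + b : ℕ)) : ℤ) : ℚ_[p]) ≠ 0 := by
      intro h
      have h0 : ((p * a + b : ℕ) * (2 * (p * n : ℕ) - 3 * (p * a + b : ℕ)) : ℤ) = 0 := by
        exact_mod_cast h
      rcases mul_eq_zero.1 h0 with h | h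
      · apply hjq; exact_mod_cast congrArg (Int.cast (R := ZMod p)) h
      · apply hmq; rw [h]; simp
    have hne2 : ((p : ℚ_[p]) * n) ^ 2 ≠ 0 := by
      have : ((p * n : ℕ) : ℚ_[p]) ≠ 0 := by exact_mod_cast hN.ne'
      push_cast at this
      exact pow_ne_zero _ this
    rw [div_eq_div_iff hne2 hne]
    have : ((p : ℚ_[p]) * n) ^ 2 = (((p * n : ℕ) ^ 2 : ℤ) : ℚ_[p]) := by push_cast; ring
    rw [this, ← Int.cast_mul, ← Int.cast_mul]
    congr 1
    generalize ((p * n).choose (p * a + b)) = A at *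
    generalize ((2 * (p * n) - 3 * (p * a + b) - 1).choose (p * n - 1)) = B at *
    generalize ((p * n - 1).choose (p * a + b - 1)) = A' at *
    generalize ((2 * (p * n) - 3 * (p * a + b)).choose (p * n)) = B' at *
    generalize p * n = N at *
    generalize p * a + b = j at *
    linear_combination ((-1) ^ j * (A : ℤ) * j) * id2 - ((-1) ^ j * (B' : ℤ) * N) * id1'
  · rw [Int.cast_mul, Int.cast_mul, Int.cast_mul, hmz, Int.cast_natCast, Int.cast_natCast,
      Int.cast_natCast, L1, L2, hjz, ww]
    push_cast
    generalize (((n - 1).choose a : ℕ) : ZMod p) = u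
    generalize (((2 * n - 3 * a - (3 * b / p + 1)).choose n : ℕ) : ZMod p) = v
    have : (-1 : ZMod p) ^ (p * a + b) * ((-1) ^ (b - 1) * u * v) = -(-1) ^ a * u * v := by
      rw [← hs]; ring
    rw [this]
    field_simp

lemma mainRR (hp3 : 3 < p) (n : ℕ) (hn : 0 < n) :
    RR p (((centralTrinomial (p * n) : ℚ_[p]) - centralTrinomial n) / (p * n : ℚ_[p]) ^ 2)
      (S1 p / 3 * (centralTrinomial (n - 1) : ℕ)) := by
  have hp0 := hp.out.pos
  have e1 : (centralTrinomial (p * n) : ℚ_[p]) = ∑ j ∈ range (p * n), (tt (p * n) j : ℚ_[p]) := by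
    have := tri2 (p * n) (by positivity)
    rw [← Int.cast_natCast, this, Int.cast_sum]
    rfl
  have e2 : (centralTrinomial n : ℚ_[p]) = ∑ a ∈ range n, (tt n a : ℚ_[p]) := by
    have := tri2 n hn
    rw [← Int.cast_natCast, this, Int.cast_sum]
    rfl
  have e3 : ((centralTrinomial (p * n) : ℚ_[p]) - centralTrinomial n) / (p * n : ℚ_[p]) ^ 2 =
      ∑ a ∈ range n, (((tt (p * n) (p * a) : ℚ_[p]) - (tt n a : ℚ_[p])) / (p * n : ℚ_[p]) ^ 2 +
        ∑ b ∈ Ico 1 p, (tt (p * n) (p * a + b) : ℚ_[p]) / (p * n : ℚ_[p]) ^ 2) := by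
    rw [e1, e2, sum_blocks p hp0, ← sum_sub_distrib, sum_div]
    refine sum_congr rfl fun a _ => ?_
    rw [← sum_div, ← add_div]
    congr 1
    ring
  rw [e3]
  have h1 : RR p _ _ := RR.sum (p := p) (range n) _ _ fun a ha =>
    (c0 p hp3 n a (mem_range.1 ha)).add (RR.sum (Ico 1 p) _ _ fun b hb =>
      c1 p hp3 n a b hn (by have := mem_Ico.1 hb; omega) (mem_Ico.1 hb).2)
  convert h1 using 1
  have t3 := congrArg (Int.cast (R := ZMod p)) (tri3 n hn)
  rw [Int.cast_natCast] at t3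
  rw [t3, Int.cast_sum, mul_sum]
  refine sum_congr rfl fun a _ => ?_
  rw [← mul_sum, sum_third p hp3 (fun c => ((2 * n - 3 * a - c).choose n : ℕ)), zero_add]
  push_cast
  ring

lemma bern_int (k : ℕ) (hk : k ≤ p - 2) : ∃ r, RR p ((bernoulli k : ℚ) : ℚ_[p]) r := by
  induction k using Nat.strong_induction_on with
  | _ k ih =>
    have h := sum_bernoulli (k + 1)
    rw [sum_range_succ, Nat.choose_succ_self_right] at h
    have hk0 : ((k + 1 : ℕ) : ZMod p) ≠ 0 := by
      rw [Ne, ZMod.natCast_eq_zero_iff]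
      intro hd
      have := Nat.le_of_dvd (by omega) hd
      have := hp.out.two_le
      omega
    have hk1 : ((k : ℚ) + 1) ≠ 0 := by positivity
    have e : bernoulli k = (((if k + 1 = 1 then 1 else 0 : ℤ) : ℚ) -
        ∑ i ∈ range k, ((k + 1).choose i : ℚ) * bernoulli i) / ((k + 1 : ℕ) : ℚ) := by
      rw [eq_div_iff (by exact_mod_cast hk1)]
      push_cast at h ⊢
      linear_combination h
    have hi : ∀ i, ∃ r, i ∈ range k → RR p ((bernoulli i : ℚ) : ℚ_[p]) r := by
      intro i
      by_cases hik : i ∈ range k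
      · obtain ⟨r, hr⟩ := ih i (mem_range.1 hik) (by have := mem_range.1 hik; omega)
        exact ⟨r, fun _ => hr⟩
      · exact ⟨0, fun h => absurd h hik⟩
    choose r hr using hi
    have key : RR p _ _ := ((RR.int (p := p) (if k + 1 = 1 then 1 else 0 : ℤ)).sub
      (RR.sum (range k) _ _ fun i hi' => (RR.nat (p := p) ((k + 1).choose i)).mul (hr i hi'))).div
        (RR.nat (k + 1)) hk0
    rw [e]
    rw [Rat.cast_div, Rat.cast_sub, Rat.cast_sum, Rat.cast_intCast, Rat.cast_natCast]
    simp only [Rat.cast_mul, Rat.cast_natCast]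
    exact ⟨_, key⟩

lemma bern_poly : ∃ Q : ZMod p → ZMod p, ∀ (x : ℚ) (r : ZMod p), RR p (x : ℚ_[p]) r →
    RR p (((Polynomial.bernoulli (p - 2)).eval x : ℚ) : ℚ_[p]) (Q r) := by
  have hi : ∀ i, ∃ r, i ∈ range (p - 2 + 1) → RR p ((bernoulli i : ℚ) : ℚ_[p]) r := by
    intro i
    by_cases hik : i ∈ range (p - 2 + 1)
    · obtain ⟨r, hr⟩ := bern_int p i (by have := mem_range.1 hik; omega)
      exact ⟨r, fun _ => hr⟩
    · exact ⟨0, fun h => absurd h hik⟩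
  choose r hr using hi
  refine ⟨fun s => ∑ i ∈ range (p - 2 + 1), r i * ((p - 2).choose i : ℕ) * s ^ (p - 2 - i), ?_⟩
  intro x s hx
  have e : (Polynomial.bernoulli (p - 2)).eval x =
      ∑ i ∈ range (p - 2 + 1), bernoulli i * ((p - 2).choose i : ℕ) * x ^ (p - 2 - i) := by
    rw [Polynomial.bernoulli, Polynomial.eval_finsetSum]
    simp
  rw [e, Rat.cast_sum]
  refine RR.sum _ _ _ fun i hi => ?_
  rw [Rat.cast_mul, Rat.cast_mul, Rat.cast_natCast, Rat.cast_pow]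
  exact ((hr i hi).mul (RR.nat _)).mul (hx.pow _)

lemma S1_eq (hp3 : 3 < p) : S1 p = ∑ k ∈ range (p / 3 + 1), (k : ZMod p) ^ (p - 3) := by
  rw [S1, ← sum_filter, sum_range_eq_add_Ico _ (by omega), Nat.cast_zero, zero_pow (by omega), zero_add]
  have : (Ico 1 p).filter (fun b => 3 * b / p = 0) = Ico 1 (p / 3 + 1) := by
    ext b
    rw [mem_filter, mem_Ico, mem_Ico, Nat.div_eq_zero_iff]
    have h3 : ¬ 3 ∣ p := by
      intro h
      have := (Nat.prime_dvd_prime_iff_eq Nat.prime_three hp.out).1 h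
      omega
    omega
  rw [this]
  refine sum_congr rfl fun b hb => ww_eq p b hp3 ?_
  have hb' := mem_Ico.1 hb
  rw [Ne, ZMod.natCast_eq_zero_iff]
  intro h
  have := Nat.le_of_dvd (by omega) h
  omega

lemma bernRR (hp3 : 3 < p) :
    RR p (((legendreSym 3 p : ℚ) * (Polynomial.bernoulli (p - 2)).eval (1 / 3 : ℚ) : ℚ) : ℚ_[p])
      (2 * S1 p) := by
  obtain ⟨Q, hQ⟩ := bern_poly p
  have hodd : Odd p := hp.out.odd_of_ne_two (by omega)
  have hodd2 : Odd (p - 2) := by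
    obtain ⟨c, hc⟩ := hodd
    exact ⟨c - 1, by omega⟩
  have hq := hQ ((p / 3 + 1 : ℕ) : ℚ) ((p / 3 + 1 : ℕ) : ZMod p) (by
    rw [Rat.cast_natCast]; exact RR.nat _)
  have hb := Polynomial.bernoulli_succ_eval (p / 3 + 1) (p - 3)
  rw [show (p - 3).succ = p - 2 by omega, bernoulli_eq_zero_of_odd hodd2 (by omega), zero_add] at hb
  have hval : Q ((p / 3 + 1 : ℕ) : ZMod p) = -2 * S1 p := by
    refine RR.unique hq ?_
    rw [hb, S1_eq p hp3]
    have key : RR p _ _ := (RR.nat (p := p) (p - 2)).mul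
      (RR.sum (range (p / 3 + 1)) _ _ fun k _ => (RR.nat (p := p) k).pow (p - 3))
    convert key using 1
    · rw [Rat.cast_mul, Rat.cast_sum]
      congr 1
      · rw [show p - 2 = p - 3 + 1 by omega]
        push_cast
        ring
    · congr 1
      rw [Nat.cast_sub (by omega)]
      simp
  have h30 : (3 : ZMod p) ≠ 0 := by
    have : ((3 : ℕ) : ZMod p) ≠ 0 := by
      rw [Ne, ZMod.natCast_eq_zero_iff]
      intro h
      have := Nat.le_of_dvd (by omega) h
      omega
    exact_mod_cast this
  have h13 : RR p (((1 / 3 : ℚ)) : ℚ_[p]) (1 / 3) := by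
    have := (RR.int (p := p) 1).div (RR.int (p := p) 3) (by exact_mod_cast h30)
    simpa using this
  have h3 : ¬ 3 ∣ p := by
    intro h
    have := (Nat.prime_dvd_prime_iff_eq Nat.prime_three hp.out).1 h
    omega
  rcases (by omega : p % 3 = 1 ∨ p % 3 = 2) with hm | hm
  · have hl : legendreSym 3 p = 1 := by
      rw [legendreSym.mod, show ((p : ℤ) % ((3 : ℕ) : ℤ)) = 1 by omega]
      simp
    have hz : ((p / 3 + 1 : ℕ) : ZMod p) = 1 - 1 / 3 := by
      have e : 3 * (p / 3 + 1) = p + 2 := by omega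
      have := congrArg (Nat.cast (R := ZMod p)) e
      push_cast at this ⊢
      rw [CharP.cast_eq_zero (ZMod p) p] at this
      field_simp
      linear_combination this
    have h2 := hQ (1 - 1 / 3) (1 - 1 / 3) (by
      have := (RR.int (p := p) 1).sub h13
      simpa using this)
    rw [← hz, hval, Polynomial.bernoulli_eval_one_sub, hodd2.neg_one_pow] at h2
    have := h2.neg
    rw [hl]
    convert this using 1
    · push_cast; ring
    · ring
  · have hl : legendreSym 3 p = -1 := by
      rw [legendreSym.mod, show ((p : ℤ) % ((3 : ℕ) : ℤ)) = 2 by omega]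
      decide
    have hz : ((p / 3 + 1 : ℕ) : ZMod p) = 1 / 3 := by
      have e : 3 * (p / 3 + 1) = p + 1 := by omega
      have := congrArg (Nat.cast (R := ZMod p)) e
      push_cast at this ⊢
      rw [CharP.cast_eq_zero (ZMod p) p] at this
      field_simp
      linear_combination this
    have h2 := hQ (1 / 3) (1 / 3) h13
    rw [← hz, hval] at h2
    have := h2.neg
    rw [hl]
    convert this using 1
    · push_cast; ring
    · ring

end main

end TrinProof

theorem trinomial_supercongruence (p : ℕ) [hp : Fact p.Prime] (hp3 : 3 < p)
    (n : ℕ) (hn : 0 < n) :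
    ‖((((centralTrinomial (p * n) : ℚ) - centralTrinomial n) / (p * n) ^ 2 : ℚ) : ℚ_[p])‖ ≤ 1 ∧
    ‖((((centralTrinomial (p * n) : ℚ) - centralTrinomial n) / (p * n) ^ 2
        - (centralTrinomial (n - 1) : ℚ) / 6 * (legendreSym 3 p : ℚ)
            * (Polynomial.bernoulli (p - 2)).eval (1 / 3 : ℚ) : ℚ) : ℚ_[p])‖
      ≤ ((p : ℝ))⁻¹ := by

  have hx := TrinProof.mainRR p hp3 n hn
  have hb := TrinProof.bernRR p hp3
  have h60 : ((6 : ℤ) : ZMod p) ≠ 0 := by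
    have h : ((2 * 3 : ℕ) : ZMod p) ≠ 0 := by
      rw [Ne, ZMod.natCast_eq_zero_iff, hp.out.dvd_mul]
      rintro (h | h) <;> have := Nat.le_of_dvd (by omega) h <;> omega
    exact_mod_cast h
  have h30 : (3 : ZMod p) ≠ 0 := by
    intro h
    apply h60
    push_cast
    linear_combination 2 * h
  have hy := ((TrinProof.RR.nat (p := p) (centralTrinomial (n - 1))).div (TrinProof.RR.int 6) h60).mul hb
  have hxy := hx.sub hy
  have hxc : ((((centralTrinomial (p * n) : ℚ) - centralTrinomial n) / (p * n) ^ 2 : ℚ) : ℚ_[p]) =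
      ((centralTrinomial (p * n) : ℚ_[p]) - centralTrinomial n) / (p * n : ℚ_[p]) ^ 2 := by
    push_cast
    ring
  refine ⟨?_, ?_⟩
  · rw [hxc]
    exact hx.norm_le
  · apply TrinProof.RR.norm_le_inv
    rw [Rat.cast_sub, hxc]
    convert hxy using 1
    · push_cast
      ring
    · have h6 : (6 : ZMod p) ≠ 0 := by exact_mod_cast h60
      push_cast
      field_simp
      ring
end

section
/- Let p > 3 be a prime and let n be a positive integer, and let ν_p(n) denote the p-adic valuation of n. Then T_{pn} − T_n ≡ (T_{n−1}/6) · (p/3) · B_{p−2}(1/3) · (pn)^2 (mod p^{3+2ν_p(n)}), i.e., the p-adic valuation of the rational number T_{pn} − T_n − (T_{n−1}/6)(p/3)B_{p−2}(1/3)(pn)^2 is at least 3 + 2ν_p(n). -/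
/-- The sequence `a_m`. -/
def aa (m : ℕ) : ℤ := if m % 3 = 0 then -2 else 1

/-- The quadratic character mod 3. -/
def chi (m : ℕ) : ℤ := if m % 3 = 1 then 1 else if m % 3 = 2 then -1 else 0

section formal
open PowerSeries
variable (R : Type*) [CommRing R]

noncomputable def FF : R⟦X⟧ := 1 + X + X ^ 2
noncomputable def LL : R⟦X⟧ := PowerSeries.mk fun m => if m = 0 then 0 else (aa m : R)
noncomputable def QQ : R⟦X⟧ := PowerSeries.mk fun m => (chi (m + 1) : R)

variable {R}

lemma coeff_FF_mul_zero (f : R⟦X⟧) : coeff 0 (FF R * f) = coeff 0 f := by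
  simp [FF]

lemma coeff_FF_mul_one (f : R⟦X⟧) : coeff 1 (FF R * f) = coeff 1 f + coeff 0 f := by
  have e : FF R * f = f + X * f + X * (X * f) := by simp only [FF]; ring
  rw [e, map_add, map_add, show (1 : ℕ) = 0 + 1 from rfl, coeff_succ_X_mul, coeff_succ_X_mul]
  simp

lemma coeff_FF_mul_add_two (f : R⟦X⟧) (m : ℕ) :
    coeff (m + 2) (FF R * f) = coeff (m + 2) f + coeff (m + 1) f + coeff m f := by
  have e : FF R * f = f + X * f + X * (X * f) := by simp only [FF]; ring
  rw [e, map_add, map_add, coeff_succ_X_mul, coeff_succ_X_mul, coeff_succ_X_mul]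

lemma chi_sum (m : ℕ) : chi (m + 2) + chi (m + 1) + chi m = 0 := by
  unfold chi; have : m % 3 = 0 ∨ m % 3 = 1 ∨ m % 3 = 2 := by omega
  rcases this with h | h | h <;> simp [Nat.add_mod, h]

lemma aa_sum (m : ℕ) : aa (m + 2) + aa (m + 1) + aa m = 0 := by
  unfold aa; have : m % 3 = 0 ∨ m % 3 = 1 ∨ m % 3 = 2 := by omega
  rcases this with h | h | h <;> simp [Nat.add_mod, h]

lemma FF_mul_QQ : FF R * QQ R = 1 := by
  ext m
  match m with
  | 0 => simp [coeff_FF_mul_zero, QQ, chi]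
  | 1 => rw [coeff_FF_mul_one]; simp [QQ, chi]
  | m + 2 =>
    rw [coeff_FF_mul_add_two]
    have := chi_sum (m + 1)
    have h2 : ((chi (m + 1 + 2) + chi (m + 1 + 1) + chi (m + 1) : ℤ) : R) = 0 := by
      rw [this]; simp
    push_cast at h2
    simp only [QQ, coeff_mk]
    rw [coeff_one, if_neg (by omega)]
    exact h2

lemma FF_mul_LL : FF R * LL R = X * derivative R (FF R) := by
  have : X * derivative R (FF R) = X + (C 2 : R⟦X⟧) * X ^ 2 := by
    rw [show (C 2 : R⟦X⟧) = 2 from map_ofNat C 2]; simp [FF]; ring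
  rw [this]
  ext m
  match m with
  | 0 => rw [coeff_FF_mul_zero]; simp [LL]
  | 1 => rw [coeff_FF_mul_one, map_add, coeff_C_mul, coeff_X_pow, coeff_one_X]; simp [LL, aa]
  | 2 =>
    rw [coeff_FF_mul_add_two, map_add, coeff_C_mul, coeff_X_pow, coeff_X]; simp [LL, aa]; norm_num
  | m + 3 =>
    rw [coeff_FF_mul_add_two _ (m + 1), map_add, coeff_C_mul, coeff_X_pow, coeff_X]
    have h2 : ((aa (m + 1 + 2) + aa (m + 1 + 1) + aa (m + 1) : ℤ) : R) = 0 := by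
      rw [aa_sum]; simp
    push_cast at h2
    simpa [LL] using h2

lemma coeff_X_mul_derivative (f : R⟦X⟧) (m : ℕ) :
    coeff m (X * derivative R f) = m * coeff m f := by
  cases m with
  | zero => simp
  | succ m => rw [coeff_succ_X_mul, coeff_derivative]; push_cast; ring

lemma X_mul_derivative_QQ : X * derivative R (QQ R) = - (LL R * QQ R) := by
  have h := congrArg (derivative R) (FF_mul_QQ (R := R))
  rw [Derivation.leibniz, derivative_one] at h
  simp only [smul_eq_mul] at h
  have h1 := FF_mul_QQ (R := R)
  have h2 := FF_mul_LL (R := R)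
  linear_combination (X * QQ R) * h - (X * derivative R (QQ R) + LL R * QQ R) * h1 + QQ R ^ 2 * h2

lemma X_mul_derivative_expand (p : ℕ) (hp : p ≠ 0) (f : R⟦X⟧) :
    X * derivative R (expand p hp f) = (p : R⟦X⟧) * expand p hp (X * derivative R f) := by
  ext m
  rw [coeff_X_mul_derivative, ← map_natCast (C : R →+* R⟦X⟧) p, coeff_C_mul, coeff_expand, coeff_expand]
  split_ifs with h
  · obtain ⟨q, rfl⟩ := h
    rw [Nat.mul_div_cancel_left _ (Nat.pos_of_ne_zero hp), coeff_X_mul_derivative]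
    push_cast; ring
  · simp

lemma X_mul_derivative_pow {f l : R⟦X⟧} (h : X * derivative R f = l * f) (n : ℕ) :
    X * derivative R (f ^ n) = (n : R⟦X⟧) * l * f ^ n := by
  cases n with
  | zero => simp
  | succ n =>
    rw [derivative_pow]
    simp only [Nat.add_sub_cancel]
    push_cast
    linear_combination ((n : R⟦X⟧) + 1) * f ^ n * h

lemma coeff_expand_mul' (p : ℕ) (hp : p ≠ 0) (f g : R⟦X⟧) (n : ℕ) :
    coeff (p * n) (expand p hp f * g) = coeff n (f * PowerSeries.mk fun j => coeff (p * j) g) := by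
  rw [coeff_mul, coeff_mul]
  simp only [coeff_mk]
  symm
  apply Finset.sum_of_injOn (fun x => (p * x.1, p * x.2))
  · rintro ⟨a, b⟩ _ ⟨c, d⟩ _ h
    simpa [hp] using h
  · rintro ⟨a, b⟩ h
    simp at h ⊢
    rw [← mul_add, h]
  · rintro ⟨a, b⟩ h h'
    rw [coeff_expand_of_not_dvd, zero_mul]
    rintro ⟨c, rfl⟩
    simp at h
    have : p ∣ b := by
      have : p ∣ p * c + b := by rw [h]; exact dvd_mul_right _ _
      exact (Nat.dvd_add_right (dvd_mul_right _ _)).1 this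
    obtain ⟨d, rfl⟩ := this
    apply h'
    refine ⟨(c, d), ?_, rfl⟩
    simp
    rw [← mul_add] at h
    exact Nat.eq_of_mul_eq_mul_left (Nat.pos_of_ne_zero hp) h
  · rintro ⟨a, b⟩ h
    simp

lemma coeff_FF_pow (n : ℕ) : coeff n (FF R ^ n) = (centralTrinomial n : R) := by
  have e : FF R = (1 + X ^ 2) + X := by simp [FF]; ring
  have hc : ∀ k m : ℕ, coeff m ((1 + X ^ 2 : R⟦X⟧) ^ k) = if 2 ∣ m then ((k.choose (m / 2) : ℕ) : R) else 0 := by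
    intro k m
    have : (1 + X ^ 2 : R⟦X⟧) ^ k = expand 2 two_ne_zero ((1 + X) ^ k) := by
      simp
    rw [this, coeff_expand]
    split_ifs
    · have : ((1 + X : R⟦X⟧) ^ k) = (((1 + Polynomial.X) ^ k : Polynomial R) : R⟦X⟧) := by simp
      rw [this, Polynomial.coeff_coe, Polynomial.coeff_one_add_X_pow]
    · rfl
  rw [e, add_pow, map_sum]
  have : ∀ m ∈ Finset.range (n + 1), coeff n ((1 + X ^ 2 : R⟦X⟧) ^ m * X ^ (n - m) * (n.choose m : R⟦X⟧))
      = if 2 ∣ m then ((n.choose m * m.choose (m / 2) : ℕ) : R) else 0 := by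
    intro m hm
    have hm : m ≤ n := by simp at hm; omega
    rw [← map_natCast (C : R →+* R⟦X⟧), coeff_mul_C]
    conv_lhs => rw [show n = m + (n - m) by omega]
    rw [Nat.add_sub_cancel_left, coeff_mul_X_pow, hc]
    rw [show m + (n - m) = n by omega]
    split_ifs <;> push_cast <;> ring
  rw [Finset.sum_congr rfl this, centralTrinomial]
  push_cast
  symm
  apply Finset.sum_of_injOn (fun k => 2 * k)
  · intro a _ b _ h; simpa using h
  · intro a h; simp at h ⊢; omega
  · intro m hm h'
    rw [if_neg]
    rintro ⟨c, rfl⟩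
    apply h'
    refine ⟨c, ?_, rfl⟩
    simp at hm ⊢; omega
  · intro k hk; simp
end formal
section expo
open PowerSeries
variable {R : Type*} [CommRing R] [IsDomain R] [CharZero R]

/-- truncated exponential identity -/
lemma expo_identity (p : ℕ) (hp : p ≠ 0) (n N : ℕ) (γ : ℕ → R) (hγ0 : γ 0 = 1)
    (hγ : ∀ k : ℕ, ((k : R) + 1) * γ (k + 1) = (p * n : R) * γ k)
    (S : R⟦X⟧) (hS0 : constantCoeff S = 0)
    (hS : X * derivative R S = LL R - expand p hp (LL R)) :
    ∃ D : R⟦X⟧, FF R ^ (p * n) = expand p hp (FF R) ^ n *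
      (∑ k ∈ Finset.range (N + 1), C (γ k) * S ^ k) + X ^ N * D := by
  set E : R⟦X⟧ := ∑ k ∈ Finset.range (N + 1), C (γ k) * S ^ k with hE
  set Fp := expand p hp (FF R) with hFp
  set Lp := expand p hp (LL R) with hLp
  set c : R⟦X⟧ := (p : R⟦X⟧) * n with hc
  have hXS : X ∣ S := X_dvd_iff.2 hS0
  have hE' : derivative R E = c * derivative R S * (E - C (γ N) * S ^ N) := by
    rw [hE, map_sum, Finset.sum_range_succ', Finset.sum_range_succ (fun k => C (γ k) * S ^ k),
      add_sub_cancel_right, Finset.mul_sum]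
    simp only [pow_zero, mul_one, derivative_C, add_zero]
    apply Finset.sum_congr rfl
    intro k _
    rw [Derivation.leibniz, derivative_C, derivative_pow]
    have h1 : (C ((k : R) + 1) : R⟦X⟧) * C (γ (k + 1)) = c * C (γ k) := by
      rw [← map_mul, hγ, map_mul, map_mul, map_natCast, map_natCast]
    rw [map_add, map_natCast, map_one] at h1
    simp only [smul_eq_mul, mul_zero, add_zero, Nat.add_sub_cancel]
    push_cast
    linear_combination (S ^ k * derivative R S) * h1
  have hFp' : X * derivative R Fp = ((p : R⟦X⟧) * Lp) * Fp := by
    rw [hFp, X_mul_derivative_expand, ← FF_mul_LL, map_mul]; ring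
  have hFpn := X_mul_derivative_pow hFp' n
  have hQn := X_mul_derivative_pow (f := QQ R) (l := - LL R)
    (by rw [X_mul_derivative_QQ]; ring) (p * n)
  set Dd := Fp ^ n * E * QQ R ^ (p * n) with hDd
  have hD : X * derivative R Dd = - (c * Fp ^ n * QQ R ^ (p * n) * C (γ N) * (LL R - Lp) * S ^ N) := by
    rw [hDd, Derivation.leibniz, Derivation.leibniz, hE']
    simp only [smul_eq_mul]
    push_cast at hQn
    linear_combination (Fp ^ n * E) * hQn + (QQ R ^ (p * n) * E) * hFpn + QQ R ^ (p * n) * Fp ^ n *  c * (E - C (γ N) * S ^ N) * hS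
  have hdvd : X ^ N ∣ X * derivative R Dd := by
    rw [hD]
    exact (dvd_mul_of_dvd_right (pow_dvd_pow_of_dvd hXS N) _).neg_right
  have hdvd2 : X ^ N ∣ Dd - 1 := by
    rw [X_pow_dvd_iff] at hdvd ⊢
    intro m hm
    have h1 := hdvd m hm
    rw [coeff_X_mul_derivative] at h1
    rcases Nat.eq_zero_or_pos m with rfl | hm0
    · have hF0 : constantCoeff Fp = 1 := by rw [hFp, constantCoeff_expand]; simp [FF]
      have hQ0 : constantCoeff (QQ R) = 1 := by
        rw [← coeff_zero_eq_constantCoeff_apply]; simp [QQ, chi]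
      have hE0 : constantCoeff E = 1 := by
        rw [hE, Finset.sum_range_succ']
        simp [hS0, hγ0]
      simp [hDd, hF0, hQ0, hE0]
    · have : (m : R) ≠ 0 := by exact_mod_cast hm0.ne'
      have := (mul_eq_zero.1 h1).resolve_left this
      rw [map_sub, this, coeff_one, if_neg hm0.ne', sub_zero]
  obtain ⟨G, hG⟩ := hdvd2
  refine ⟨- (FF R ^ (p * n) * G), ?_⟩
  have h1 : FF R ^ (p * n) * QQ R ^ (p * n) = 1 := by
    rw [← mul_pow, FF_mul_QQ, one_pow]
  rw [hDd] at hG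
  linear_combination (-FF R ^ (p * n)) * hG  + (Fp ^ n * E) * h1
end expo
section modp
open Finset

lemma aa_mul (k l : ℕ) : aa k * aa l = -(aa (k + l) + aa (k + l + k)) := by
  unfold aa
  have h1 : k % 3 = 0 ∨ k % 3 = 1 ∨ k % 3 = 2 := by omega
  have h2 : l % 3 = 0 ∨ l % 3 = 1 ∨ l % 3 = 2 := by omega
  rcases h1 with h1 | h1 | h1 <;> rcases h2 with h2 | h2 | h2 <;> simp [Nat.add_mod, h1, h2]

lemma aa_congr {k l : ℕ} (h : k % 3 = l % 3) : aa k = aa l := by simp [aa, h]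

lemma aa_neg {k l : ℕ} (h : (k + l) % 3 = 0) : aa k = aa l := by
  have : k % 3 = 0 ↔ l % 3 = 0 := by omega
  simp [aa, this]

lemma aa_partial_sum (m : ℕ) : ∑ i ∈ range m, aa i =
    if m % 3 = 0 then 0 else if m % 3 = 1 then -2 else -1 := by
  induction m with
  | zero => simp
  | succ m ih =>
    rw [sum_range_succ, ih]; unfold aa
    have h1 : m % 3 = 0 ∨ m % 3 = 1 ∨ m % 3 = 2 := by omega
    rcases h1 with h1 | h1 | h1 <;> simp [Nat.add_mod, h1]

lemma aa_window (j : ℕ) : ∑ i ∈ range j, aa (i + j + 2) = -2 * chi j := by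
  have h := sum_range_add aa (j + 2) j
  rw [aa_partial_sum, aa_partial_sum] at h
  have e : ∑ i ∈ range j, aa (i + j + 2) = ∑ x ∈ range j, aa (j + 2 + x) :=
    sum_congr rfl fun i _ => by congr 1; ring
  rw [e]
  unfold chi
  have h1 : j % 3 = 0 ∨ j % 3 = 1 ∨ j % 3 = 2 := by omega
  rcases h1 with h1 | h1 | h1 <;> simp [Nat.add_mod, h1] at h ⊢ <;> linarith

lemma sum_range_mul_block {M : Type*} [AddCommMonoid M] (p j : ℕ) (f : ℕ → M) :
    ∑ k ∈ range (p * j), f k = ∑ i ∈ range j, ∑ r ∈ range p, f (p * i + r) := by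
  induction j with
  | zero => simp
  | succ j ih => rw [mul_add, mul_one, sum_range_add, ih, sum_range_succ]

variable (p : ℕ) [hp : Fact p.Prime]

lemma sum_range_zmod {M : Type*} [AddCommMonoid M] (f : ZMod p → M) :
    ∑ r ∈ range p, f (r : ZMod p) = ∑ x : ZMod p, f x := by
  apply sum_nbij' (fun r : ℕ => (r : ZMod p)) (fun x : ZMod p => x.val)
  · simp
  · intro x _; simp [ZMod.val_lt]
  · intro r hr; simp at hr; exact ZMod.val_cast_of_lt hr
  · intro x _; simp
  · simp

lemma sum_inv_sq (hp3 : 3 < p) : ∑ r ∈ range p, ((r : ZMod p)⁻¹) ^ 2 = 0 := by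
  rw [sum_range_zmod p (fun x => (x⁻¹) ^ 2)]
  rw [Fintype.sum_equiv (Equiv.inv (ZMod p)) (fun x => (x⁻¹) ^ 2) (fun x => x ^ 2) (by simp)]
  apply FiniteField.sum_pow_lt_card_sub_one
  rw [ZMod.card]; omega

/-- the sums `h_c` -/
noncomputable def hh (c : ℕ) : ZMod p := ∑ r ∈ range p, (aa (p * c + r) : ZMod p) * ((r : ZMod p)⁻¹) ^ 2

variable {p}

lemma mod3 (hp3 : 3 < p) : p % 3 = 1 ∨ p % 3 = 2 := by
  have : ¬ 3 ∣ p := fun h => by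
    have := (Nat.prime_dvd_prime_iff_eq Nat.prime_three hp.out).1 h
    omega
  omega

lemma hh_two (hp3 : 3 < p) : hh p 2 = hh p 0 := by
  obtain ⟨q, hq⟩ : ∃ q, p = q + 1 := ⟨p - 1, by omega⟩
  unfold hh
  have hr : range p = range (q + 1) := by rw [hq]
  rw [hr, sum_range_succ', sum_range_succ', ← sum_range_reflect]
  simp only [Nat.cast_zero, inv_zero, ne_eq, OfNat.ofNat_ne_zero, not_false_eq_true, zero_pow,
    mul_zero, add_zero]
  apply sum_congr rfl
  intro r hr
  simp at hr
  have e1 : q - 1 - r + 1 = p - (r + 1) := by omega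
  rw [e1, Nat.cast_sub (by omega), ZMod.natCast_self, zero_sub, inv_neg, neg_sq]
  congr 2
  apply aa_neg
  omega

lemma hh_sum (hp3 : 3 < p) : hh p 2 + hh p 1 + hh p 0 = 0 := by
  unfold hh
  rw [← sum_add_distrib, ← sum_add_distrib]
  apply sum_eq_zero
  intro r _
  have : aa (p * 2 + r) + aa (p * 1 + r) + aa (p * 0 + r) = 0 := by
    have hr : r % 3 = 0 ∨ r % 3 = 1 ∨ r % 3 = 2 := by omega
    unfold aa
    rcases mod3 hp3 with h | h <;> rcases hr with hr | hr | hr <;>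
      simp [Nat.add_mod, Nat.mul_mod, h, hr]
  have h2 : ((aa (p * 2 + r) + aa (p * 1 + r) + aa (p * 0 + r) : ℤ) : ZMod p) = 0 := by
    rw [this]; simp
  push_cast at h2
  linear_combination ((r : ZMod p)⁻¹) ^ 2 * h2

lemma hh_congr {c d : ℕ} (h : c % 3 = d % 3) : hh p c = hh p d := by
  unfold hh
  apply sum_congr rfl
  intro r _
  congr 2
  apply aa_congr
  simp [Nat.add_mod, Nat.mul_mod, h]

lemma hh_eq (hp3 : 3 < p) (c : ℕ) : hh p c = (aa (c + 2) : ZMod p) * hh p 0 := by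
  have h2 := hh_two hp3
  have h3 := hh_sum hp3
  have hr : c % 3 = 0 ∨ c % 3 = 1 ∨ c % 3 = 2 := by omega
  rcases hr with hr | hr | hr
  · rw [hh_congr (d := 0) hr]; simp [aa, Nat.add_mod, hr]
  · rw [hh_congr (d := 1) hr]; simp [aa, Nat.add_mod, hr]
    linear_combination h3 - h2
  · rw [hh_congr (d := 2) hr, h2]; simp [aa, Nat.add_mod, hr]

lemma sum_conv (hp3 : 3 < p) (j : ℕ) :
    ∑ k ∈ range (p * j + 1), ((aa k : ZMod p) * (k : ZMod p)⁻¹) *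
      ((aa (p * j - k) : ZMod p) * ((p * j - k : ℕ) : ZMod p)⁻¹) = -2 * chi j * hh p 0 := by
  rw [sum_range_succ]
  simp only [Nat.sub_self, Nat.cast_zero, inv_zero, mul_zero, add_zero]
  have h1 : ∀ k ∈ range (p * j), ((aa k : ZMod p) * (k : ZMod p)⁻¹) *
      ((aa (p * j - k) : ZMod p) * ((p * j - k : ℕ) : ZMod p)⁻¹) =
      ((aa (p * j) : ZMod p) + aa (p * j + k)) * ((k : ZMod p)⁻¹) ^ 2 := by
    intro k hk
    simp at hk
    have e := aa_mul k (p * j - k)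
    rw [show k + (p * j - k) = p * j by omega] at e
    have e' : (aa k : ZMod p) * (aa (p * j - k) : ZMod p) = -((aa (p * j) : ZMod p) + aa (p * j + k)) := by
      exact_mod_cast congrArg (Int.cast : ℤ → ZMod p) e
    rw [Nat.cast_sub hk.le, Nat.cast_mul, ZMod.natCast_self, zero_mul, zero_sub, inv_neg]
    linear_combination (-((k : ZMod p)⁻¹) ^ 2) * e'
  rw [sum_congr rfl h1, sum_range_mul_block]
  have h2 : ∀ i ∈ range j, ∑ r ∈ range p, ((aa (p * j) : ZMod p) + aa (p * j + (p * i + r))) *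
      (((p * i + r : ℕ) : ZMod p)⁻¹) ^ 2 = (aa (i + j + 2) : ZMod p) * hh p 0 := by
    intro i _
    rw [← hh_eq hp3]
    have : ∑ r ∈ range p, ((aa (p * j) : ZMod p) + aa (p * j + (p * i + r))) *
      (((p * i + r : ℕ) : ZMod p)⁻¹) ^ 2 = (aa (p * j) : ZMod p) * (∑ r ∈ range p, ((r : ZMod p)⁻¹) ^ 2) + hh p (i + j) := by
      rw [mul_sum, hh, ← sum_add_distrib]
      apply sum_congr rfl
      intro r _
      rw [show p * (i + j) + r = p * j + (p * i + r) by ring]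
      push_cast
      rw [ZMod.natCast_self, zero_mul, zero_add]
      ring
    rw [this, sum_inv_sq p hp3]; ring
  rw [sum_congr rfl h2, ← sum_mul, ← Int.cast_sum, aa_window]
  push_cast; ring

lemma hh_zero (hp3 : 3 < p) :
    3 * hh p 0 = - ∑ k ∈ range (p / 3 + 1), (k : ZMod p) ^ (p - 3) := by
  have h3 : (3 : ZMod p) ≠ 0 := by
    intro h
    have : ((3 : ℕ) : ZMod p) = 0 := by exact_mod_cast h
    rw [ZMod.natCast_eq_zero_iff] at this
    have := Nat.le_of_dvd (by norm_num) this
    omega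
  have hpow : ∀ k : ℕ, (k : ZMod p) ^ (p - 3) = ((k : ZMod p)⁻¹) ^ 2 := by
    intro k
    by_cases hk : (k : ZMod p) = 0
    · rw [hk]; rw [zero_pow (by omega)]; simp
    · have := ZMod.pow_card_sub_one_eq_one hk
      rw [show p - 1 = p - 3 + 2 by omega, pow_add] at this
      rw [inv_pow]
      exact eq_inv_of_mul_eq_one_left this
  have h1 : hh p 0 = -3 * ∑ r ∈ range p, if 3 ∣ r then ((r : ZMod p)⁻¹) ^ 2 else 0 := by
    have : hh p 0 = (∑ r ∈ range p, ((r : ZMod p)⁻¹) ^ 2) + -3 * ∑ r ∈ range p, if 3 ∣ r then ((r : ZMod p)⁻¹) ^ 2 else 0 := by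
      rw [hh, mul_sum, ← sum_add_distrib]
      apply sum_congr rfl
      intro r _
      simp only [mul_zero, zero_add, aa, Nat.dvd_iff_mod_eq_zero]
      split_ifs <;> push_cast <;> ring
    rw [this, sum_inv_sq p hp3, zero_add]
  have h2 : ∑ k ∈ range (p / 3 + 1), ((3 * k : ℕ) : ZMod p)⁻¹ ^ 2
      = ∑ r ∈ range p, if 3 ∣ r then ((r : ZMod p)⁻¹) ^ 2 else 0 := by
    apply Finset.sum_of_injOn (fun k => 3 * k)
    · intro a _ b _ h; simpa using h
    · have := mod3 hp3
      intro a h; simp at h ⊢; omega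
    · intro m hm h'
      rw [if_neg]
      rintro ⟨c, rfl⟩
      apply h'
      refine ⟨c, ?_, rfl⟩
      simp at hm ⊢; omega
    · intro k hk; simp
  rw [h1, ← h2, sum_congr rfl fun k _ => hpow k, mul_sum, mul_sum, ← sum_neg_distrib]
  apply sum_congr rfl
  intro k _
  push_cast
  rw [mul_inv]
  field_simp
end modp
section bern
open Finset
variable {p : ℕ} [hp : Fact p.Prime]

lemma norm_natCast_of_lt {k : ℕ} (hk0 : 0 < k) (hk : k < p) :
    ‖(k : ℚ_[p])‖ = 1 := by
  rw [Padic.norm_natCast_eq_one_iff]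
  exact Nat.coprime_of_lt_prime hk0.ne' hk hp.out

lemma bernoulli_norm_le (k : ℕ) (hk : k + 1 < p) : ‖((bernoulli k : ℚ) : ℚ_[p])‖ ≤ 1 := by
  induction k using Nat.strong_induction_on with
  | _ k ih =>
    have h := sum_bernoulli (k + 1)
    rw [sum_range_succ] at h
    have h1 : ((k + 1 : ℕ) : ℚ) * bernoulli k = (if k + 1 = 1 then 1 else 0) -
        ∑ i ∈ range k, ((k + 1).choose i : ℚ) * bernoulli i := by
      rw [← h]; simp
    have h2 := congrArg (fun x : ℚ => ‖(x : ℚ_[p])‖) h1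
    simp only [Rat.cast_mul, Rat.cast_natCast, norm_mul] at h2
    rw [norm_natCast_of_lt (by omega) hk, one_mul] at h2
    rw [h2, Rat.cast_sub]
    change _ ∈ PadicInt.subring p
    apply sub_mem
    · split_ifs
      · rw [Rat.cast_one]; exact one_mem _
      · rw [Rat.cast_zero]; exact zero_mem _
    · rw [Rat.cast_sum]
      apply sum_mem
      intro i hi
      simp at hi
      rw [Rat.cast_mul, Rat.cast_natCast]
      exact mul_mem (natCast_mem _ _) (ih i hi (by omega))

noncomputable def bz (p : ℕ) [Fact p.Prime] (i : ℕ) : ℤ_[p] :=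
  if h : ‖((bernoulli i : ℚ) : ℚ_[p])‖ ≤ 1 then ⟨_, h⟩ else 0

noncomputable def BP (p : ℕ) [Fact p.Prime] : Polynomial ℤ_[p] :=
  ∑ i ∈ range (p - 2 + 1), Polynomial.monomial (p - 2 - i) (bz p i * ((p - 2).choose i : ℤ_[p]))

lemma BP_eval (hp3 : 3 < p) (x : ℚ) (y : ℤ_[p]) (h : (y : ℚ_[p]) = (x : ℚ_[p])) :
    (((BP p).eval y : ℤ_[p]) : ℚ_[p]) = (((Polynomial.bernoulli (p - 2)).eval x : ℚ) : ℚ_[p]) := by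
  rw [BP, Polynomial.bernoulli, Polynomial.eval_finsetSum, Polynomial.eval_finsetSum,
    PadicInt.coe_sum, Rat.cast_sum]
  apply sum_congr rfl
  intro i hi
  simp at hi
  rw [Polynomial.eval_monomial, Polynomial.eval_monomial]
  have hb : ((bz p i : ℤ_[p]) : ℚ_[p]) = ((bernoulli i : ℚ) : ℚ_[p]) := by
    have hb := bernoulli_norm_le (p := p) i (by omega)
    have e : bz p i = ⟨_, hb⟩ := dif_pos hb
    rw [e]
  push_cast
  rw [hb, h]

lemma toZMod_eval (P : Polynomial ℤ_[p]) {x y : ℤ_[p]}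
    (h : PadicInt.toZMod x = PadicInt.toZMod y) :
    PadicInt.toZMod (P.eval x) = PadicInt.toZMod (P.eval y) := by
  rw [← Polynomial.eval_map_apply, ← Polynomial.eval_map_apply, h]

lemma legendre_three (hp3 : 3 < p) : legendreSym 3 (p : ℤ) = if p % 3 = 1 then 1 else -1 := by
  rw [legendreSym.mod]
  rcases mod3 hp3 with h | h
  · have : ((p : ℤ) % ((3 : ℕ) : ℤ)) = 1 := by omega
    rw [this, if_pos h]; simp
  · have : ((p : ℤ) % ((3 : ℕ) : ℤ)) = 2 := by omega
    rw [this, if_neg (by omega)]; decide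

lemma bernoulli_third (hp3 : 3 < p) : ∃ b : ℤ_[p],
    (b : ℚ_[p]) = (((Polynomial.bernoulli (p - 2)).eval (1 / 3 : ℚ) : ℚ) : ℚ_[p]) ∧
    2 * (∑ k ∈ range (p / 3 + 1), (k : ZMod p) ^ (p - 3)) =
      (legendreSym 3 (p : ℤ) : ZMod p) * PadicInt.toZMod b := by
  have hodd : Odd (p - 2) := by
    have := hp.out.odd_of_ne_two (by omega)
    rcases this with ⟨q, hq⟩
    exact ⟨q - 1, by omega⟩
  have h3 : ‖((3 : ℕ) : ℤ_[p])‖ = 1 := by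
    rw [PadicInt.norm_def, PadicInt.coe_natCast]; exact norm_natCast_of_lt (by norm_num) hp3
  set t : ℤ_[p] := ((3 : ℕ) : ℤ_[p]).inv with ht
  have ht3 : (3 : ℤ_[p]) * t = 1 := by exact_mod_cast PadicInt.mul_inv h3
  have htc : (t : ℚ_[p]) = ((1 / 3 : ℚ) : ℚ_[p]) := by
    have := congrArg (fun x : ℤ_[p] => (x : ℚ_[p])) ht3
    simp only [PadicInt.coe_mul, PadicInt.coe_one] at this
    have e : (((3 : ℤ_[p])) : ℚ_[p]) = 3 := by exact_mod_cast PadicInt.coe_natCast (p := p) 3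
    rw [e] at this
    push_cast
    rw [eq_div_iff (by norm_num), mul_comm]; exact this
  have htz : (3 : ZMod p) * PadicInt.toZMod t = 1 := by
    have := congrArg PadicInt.toZMod ht3
    rwa [map_mul, map_one, map_ofNat] at this
  have cinj : ∀ x y : ℤ_[p], (x : ℚ_[p]) = (y : ℚ_[p]) → x = y := fun _ _ h => Subtype.ext h
  refine ⟨(BP p).eval t, BP_eval hp3 _ _ htc, ?_⟩
  set M := p / 3 + 1 with hM
  have hsum := Polynomial.sum_range_pow_eq_bernoulli_sub M (p - 3)
  have hs : (p - 3).succ = p - 2 := by omega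
  rw [hs, bernoulli_eq_zero_of_odd hodd (by omega), sub_zero] at hsum
  have hsumz : (BP p).eval (M : ℤ_[p]) = ((p - 2 : ℕ) : ℤ_[p]) * ∑ k ∈ range M, (k : ℤ_[p]) ^ (p - 3) := by
    apply cinj
    rw [BP_eval hp3 (M : ℚ) _ (by simp), ← hsum]
    have : ((p - 2 : ℕ) : ℚ_[p]) = ((p - 3 : ℕ) : ℚ_[p]) + 1 := by
      rw [← hs]; push_cast; rfl
    push_cast
    rw [this, PadicInt.coe_sum]
    push_cast
    rfl
  have hz := congrArg PadicInt.toZMod hsumz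
  rw [map_mul, map_sum, map_natCast, Nat.cast_sub (by omega), ZMod.natCast_self, zero_sub] at hz
  simp only [map_pow, map_natCast] at hz
  have h3z : (3 : ZMod p) ≠ 0 := by
    intro h; rw [h, zero_mul] at htz; exact zero_ne_one htz
  have hpz : (p : ZMod p) = 0 := ZMod.natCast_self p
  rw [legendre_three hp3]
  rcases mod3 hp3 with h | h
  · rw [if_pos h]
    have e : 3 * M = p + 2 := by omega
    have e2 : PadicInt.toZMod (M : ℤ_[p]) = PadicInt.toZMod (1 - t) := by
      rw [map_natCast, map_sub, map_one]
      apply mul_left_cancel₀ h3z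
      have : (3 : ZMod p) * M = p + 2 := by exact_mod_cast congrArg (Nat.cast : ℕ → ZMod p) e
      rw [this, hpz]
      linear_combination htz
    have e3 : (BP p).eval (1 - t) = - (BP p).eval t := by
      apply cinj
      rw [BP_eval hp3 (1 - 1 / 3) (1 - t) (by push_cast; rw [htc]; push_cast; rfl),
        Polynomial.bernoulli_eval_one_sub, hodd.neg_one_pow]
      push_cast
      rw [BP_eval hp3 _ _ htc]; push_cast; ring
    rw [toZMod_eval _ e2, e3, map_neg] at hz
    push_cast at hz ⊢
    linear_combination hz
  · rw [if_neg (by omega)]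
    have e : 3 * M = p + 1 := by omega
    have e2 : PadicInt.toZMod (M : ℤ_[p]) = PadicInt.toZMod t := by
      rw [map_natCast]
      apply mul_left_cancel₀ h3z
      have : (3 : ZMod p) * M = p + 1 := by exact_mod_cast congrArg (Nat.cast : ℕ → ZMod p) e
      rw [this, hpz]
      linear_combination -htz
    rw [toZMod_eval _ e2] at hz
    push_cast at hz ⊢
    linear_combination hz
end bern
section final
open PowerSeries
variable {p : ℕ} [hp : Fact p.Prime]

lemma factorial_dvd (hp3 : 3 < p) (k : ℕ) : ((k.factorial : ℕ) : ℤ_[p]) ∣ (p : ℤ_[p]) ^ (k - 3) := by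
  set e := padicValNat p k.factorial with he
  have hle : e ≤ k - 3 := by
    rcases Nat.eq_zero_or_pos k with rfl | hk
    · simp [he]
    · have h := sub_one_mul_padicValNat_factorial_lt_of_ne_zero p hk.ne'
      rw [← he] at h
      have : 4 * e ≤ (p - 1) * e := Nat.mul_le_mul_right _ (by
        rcases Nat.lt_or_ge 4 p with h | h
        · omega
        · have : p = 4 := by omega
          have := hp.out
          subst p
          exact absurd this (by norm_num))
      omega
  obtain ⟨u, hu⟩ : p ^ e ∣ k.factorial := pow_padicValNat_dvd
  have hup : ¬ p ∣ u := by
    rintro ⟨w, rfl⟩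
    have : p ^ (e + 1) ∣ k.factorial := ⟨w, by rw [hu]; ring⟩
    exact pow_succ_padicValNat_not_dvd k.factorial_ne_zero this
  have hunit : IsUnit ((u : ℕ) : ℤ_[p]) := by
    rw [PadicInt.isUnit_iff, PadicInt.norm_natCast_eq_one_iff]
    exact (Nat.Prime.coprime_iff_not_dvd hp.out).2 hup
  rw [hu]; push_cast
  rw [hunit.mul_right_dvd]
  exact pow_dvd_pow _ hle

lemma exists_gamma (hp3 : 3 < p) (n : ℕ) : ∃ γ : ℕ → ℤ_[p], γ 0 = 1 ∧
    (∀ k : ℕ, ((k : ℤ_[p]) + 1) * γ (k + 1) = (p * n : ℤ_[p]) * γ k) ∧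
    ∀ k, 3 ≤ k → (p : ℤ_[p]) ^ (3 + 2 * padicValNat p n) ∣ γ k := by
  have h1 : ∀ k : ℕ, ∃ g : ℤ_[p], (p * n : ℤ_[p]) ^ k = (k.factorial : ℤ_[p]) * g ∧
      (3 ≤ k → (p : ℤ_[p]) ^ (3 + 2 * padicValNat p n) ∣ g) := by
    intro k
    obtain ⟨w, hw⟩ := factorial_dvd hp3 k
    rcases Nat.lt_or_ge k 3 with hk | hk
    · rw [Nat.sub_eq_zero_of_le hk.le, pow_zero] at hw
      refine ⟨w * (p * n : ℤ_[p]) ^ k, ?_, fun h => by omega⟩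
      rw [← mul_assoc, ← hw, one_mul]
    · obtain ⟨u, hu⟩ : p ^ (padicValNat p n) ∣ n := pow_padicValNat_dvd
      have hu' : (n : ℤ_[p]) = (p : ℤ_[p]) ^ (padicValNat p n) * u := by exact_mod_cast congrArg (Nat.cast : ℕ → ℤ_[p]) hu
      refine ⟨p ^ 3 * w * ((n : ℤ_[p]) ^ 2 * n ^ (k - 2)), ?_, fun _ => ?_⟩
      · have e1 : (p : ℤ_[p]) ^ k = p ^ 3 * p ^ (k - 3) := by rw [← pow_add]; congr 1; omega
        have e2 : (n : ℤ_[p]) ^ k = n ^ 2 * n ^ (k - 2) := by rw [← pow_add]; congr 1; omega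
        rw [mul_pow, e1, e2, hw]; ring
      · have e3 : (n : ℤ_[p]) ^ 2 = p ^ (2 * padicValNat p n) * u ^ 2 := by
          conv_lhs => rw [hu']
          ring
        rw [e3]
        exact ⟨w * u ^ 2 * n ^ (k - 2), by ring⟩
  choose γ hγ hγ3 using h1
  have hf : ∀ k : ℕ, (k.factorial : ℤ_[p]) ≠ 0 := fun k => by exact_mod_cast k.factorial_ne_zero
  refine ⟨γ, ?_, ?_, hγ3⟩
  · simpa using (hγ 0).symm
  · intro k
    apply mul_left_cancel₀ (hf k)
    have a := hγ (k + 1)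
    have b := hγ k
    rw [Nat.factorial_succ] at a
    push_cast at a
    linear_combination -a + (p * n : ℤ_[p]) * b

noncomputable def SS (p : ℕ) [Fact p.Prime] : ℤ_[p]⟦X⟧ :=
  PowerSeries.mk fun m => if p ∣ m then 0 else (aa m : ℤ_[p]) * (m : ℤ_[p]).inv

lemma inv_spec {m : ℕ} (h : ¬ p ∣ m) : (m : ℤ_[p]) * (m : ℤ_[p]).inv = 1 := by
  apply PadicInt.mul_inv
  rw [PadicInt.norm_natCast_eq_one_iff]
  exact (Nat.Prime.coprime_iff_not_dvd hp.out).2 h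

lemma SS_derivative (hp3 : 3 < p) : X * derivative ℤ_[p] (SS p) =
    LL ℤ_[p] - expand p hp.out.ne_zero (LL ℤ_[p]) := by
  ext m
  rw [coeff_X_mul_derivative, map_sub, coeff_expand]
  simp only [SS, coeff_mk, LL]
  by_cases h : p ∣ m
  · rw [if_pos h, if_pos h]
    obtain ⟨q, rfl⟩ := h
    rw [Nat.mul_div_cancel_left _ hp.out.pos]
    have e : aa (p * q) = aa q := by
      unfold aa
      have hq : q % 3 = 0 ∨ q % 3 = 1 ∨ q % 3 = 2 := by omega
      rcases mod3 hp3 with h | h <;> rcases hq with hq | hq | hq <;> simp [Nat.mul_mod, h, hq]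
    simp [hp.out.ne_zero, e]
  · have hm : m ≠ 0 := by rintro rfl; simp at h
    rw [if_neg h, if_neg h, if_neg hm]
    linear_combination (aa m : ℤ_[p]) * inv_spec h

lemma SS_map : PowerSeries.map PadicInt.toZMod (SS p) =
    PowerSeries.mk fun m => (aa m : ZMod p) * (m : ZMod p)⁻¹ := by
  ext m
  rw [coeff_map]
  simp only [SS, coeff_mk]
  split_ifs with h
  · rw [(ZMod.natCast_eq_zero_iff m p).2 h]; simp
  · rw [map_mul, map_intCast]
    congr 1
    have := congrArg PadicInt.toZMod (inv_spec h)
    rw [map_mul, map_natCast, map_one] at this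
    exact (inv_eq_of_mul_eq_one_right this).symm

lemma toZMod_K (hp3 : 3 < p) (n : ℕ) (hn : 0 < n) :
    PadicInt.toZMod (coeff (p * n) (expand p hp.out.ne_zero (FF ℤ_[p]) ^ n * SS p ^ 2)) =
      -2 * hh p 0 * (centralTrinomial (n - 1) : ZMod p) := by
  rw [← coeff_map, map_mul, map_pow, map_pow, map_expand, SS_map]
  have hF : PowerSeries.map PadicInt.toZMod (FF ℤ_[p]) = FF (ZMod p) := by simp [FF]
  rw [hF, ← map_pow, coeff_expand_mul']
  have h1 : (PowerSeries.mk fun j => coeff (p * j)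
      ((PowerSeries.mk fun m => (aa m : ZMod p) * (m : ZMod p)⁻¹) ^ 2)) =
      C (-2 * hh p 0) * (X * QQ (ZMod p)) := by
    ext j
    rw [coeff_mk, sq, coeff_mul, Finset.Nat.sum_antidiagonal_eq_sum_range_succ_mk, coeff_C_mul]
    simp only [coeff_mk]
    rw [sum_conv hp3]
    cases j with
    | zero => simp [chi]
    | succ j => rw [coeff_succ_X_mul, QQ, coeff_mk]; ring
  rw [h1]
  obtain ⟨m, rfl⟩ : ∃ m, n = m + 1 := ⟨n - 1, by omega⟩
  have h2 : FF (ZMod p) ^ (m + 1) * (C (-2 * hh p 0) * (X * QQ (ZMod p))) =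
      C (-2 * hh p 0) * (X * FF (ZMod p) ^ m) := by
    linear_combination (FF (ZMod p) ^ m * C (-2 * hh p 0) * X) * FF_mul_QQ (R := ZMod p)
  rw [h2, coeff_C_mul, coeff_succ_X_mul, coeff_FF_pow, Nat.add_sub_cancel]

lemma main_padic (hp3 : 3 < p) (n : ℕ) (hn : 0 < n) (b : ℤ_[p])
    (hb : 2 * (∑ k ∈ Finset.range (p / 3 + 1), (k : ZMod p) ^ (p - 3)) =
      (legendreSym 3 (p : ℤ) : ZMod p) * PadicInt.toZMod b) :
    (p : ℤ_[p]) ^ (3 + 2 * padicValNat p n) ∣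
      6 * ((centralTrinomial (p * n) : ℤ_[p]) - centralTrinomial n) -
        (centralTrinomial (n - 1) : ℤ_[p]) * (legendreSym 3 (p : ℤ) : ℤ_[p]) * b * (p * n) ^ 2 := by
  obtain ⟨γ, hγ0, hγ, hγ3⟩ := exists_gamma hp3 n
  have hS0 : constantCoeff (SS p) = 0 := by
    rw [← coeff_zero_eq_constantCoeff_apply]; simp [SS]
  have hN : p * n + 1 = (p * n - 2) + 3 := by
    have : 3 * 1 ≤ p * n := Nat.mul_le_mul hp3.le hn
    omega
  obtain ⟨D, hD⟩ := expo_identity p hp.out.ne_zero n (p * n + 1) γ hγ0 hγ (SS p) hS0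
    (SS_derivative hp3)
  set Fp := expand p hp.out.ne_zero (FF ℤ_[p]) ^ n with hFp
  have hc := congrArg (coeff (p * n)) hD
  rw [coeff_FF_pow, map_add, coeff_X_pow_mul', if_neg (by omega), add_zero, Finset.mul_sum, map_sum] at hc
  have ht : ∀ k, coeff (p * n) (Fp * (C (γ k) * SS p ^ k)) = γ k * coeff (p * n) (Fp * SS p ^ k) := by
    intro k
    rw [← coeff_C_mul]; congr 1; ring
  rw [Finset.sum_congr rfl fun k _ => ht k, show p * n + 1 + 1 = 3 + (p * n - 2 + 1) by omega,
    Finset.sum_range_add] at hc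
  obtain ⟨w, hw⟩ : (p : ℤ_[p]) ^ (3 + 2 * padicValNat p n) ∣
      ∑ x ∈ Finset.range (p * n - 2 + 1), γ (3 + x) * coeff (p * n) (Fp * SS p ^ (3 + x)) :=
    Finset.dvd_sum fun k _ => dvd_mul_of_dvd_left (hγ3 _ (by omega)) _
  rw [hw, Finset.sum_range_succ, Finset.sum_range_succ, Finset.sum_range_one] at hc
  have c0 : coeff (p * n) (Fp * SS p ^ 0) = (centralTrinomial n : ℤ_[p]) := by
    rw [pow_zero, mul_one, hFp, ← map_pow, coeff_expand_mul, coeff_FF_pow]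
  have c1 : coeff (p * n) (Fp * SS p ^ 1) = 0 := by
    rw [pow_one, hFp, ← map_pow, coeff_expand_mul']
    have : (PowerSeries.mk fun j => coeff (p * j) (SS p)) = 0 := by
      ext j; simp [SS]
    rw [this]; simp
  rw [c0, c1, hγ0] at hc
  set K := coeff (p * n) (Fp * SS p ^ 2) with hK
  have hKz : PadicInt.toZMod K = _ := toZMod_K hp3 n hn
  have g1 := hγ 0
  have g2 := hγ 1
  simp only [hγ0, Nat.cast_zero, Nat.cast_one, zero_add, one_mul, mul_one] at g1 g2
  rw [g1] at g2
  norm_num at g2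
  have hz : PadicInt.toZMod (3 * K - (centralTrinomial (n - 1) : ℤ_[p]) * (legendreSym 3 (p : ℤ) : ℤ_[p]) * b) = 0 := by
    rw [map_sub, map_mul, map_mul, map_mul, map_natCast, map_intCast, map_ofNat, hKz]
    have := hh_zero hp3
    linear_combination (-2 * (centralTrinomial (n - 1) : ZMod p)) * this + (centralTrinomial (n - 1) : ZMod p) * hb
  obtain ⟨z, hz⟩ : (p : ℤ_[p]) ∣ 3 * K - (centralTrinomial (n - 1) : ℤ_[p]) * (legendreSym 3 (p : ℤ) : ℤ_[p]) * b := by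
    rw [← RingHom.mem_ker, PadicInt.ker_toZMod, PadicInt.maximalIdeal_eq_span_p, Ideal.mem_span_singleton] at hz
    exact hz
  obtain ⟨u, hu⟩ : p ^ (padicValNat p n) ∣ n := pow_padicValNat_dvd
  have hu' : (n : ℤ_[p]) = (p : ℤ_[p]) ^ (padicValNat p n) * u := by
    exact_mod_cast congrArg (Nat.cast : ℕ → ℤ_[p]) hu
  have e3 : (n : ℤ_[p]) ^ 2 = p ^ (2 * padicValNat p n) * u ^ 2 := by
    conv_lhs => rw [hu']
    ring
  refine ⟨u ^ 2 * z + 6 * w, ?_⟩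
  rw [hc]
  have e4 : (p : ℤ_[p]) ^ (3 + 2 * padicValNat p n) = p ^ 3 * p ^ (2 * padicValNat p n) := pow_add _ _ _
  rw [e4]
  linear_combination (3 * K) * g2 + (p * n : ℤ_[p]) ^ 2 * hz + p ^ 3 * z * e3
end final

theorem trinomial_supercongruence_strong (p : ℕ) [hp : Fact p.Prime] (hp3 : 3 < p)
    (n : ℕ) (hn : 0 < n) :
    ‖((((centralTrinomial (p * n) : ℚ) - centralTrinomial n)
        - (centralTrinomial (n - 1) : ℚ) / 6 * (legendreSym 3 p : ℚ)
            * (Polynomial.bernoulli (p - 2)).eval (1 / 3 : ℚ) * (p * n) ^ 2 : ℚ) : ℚ_[p])‖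
      ≤ (p : ℝ) ^ (-(3 + 2 * (padicValNat p n : ℤ))) := by
  obtain ⟨b, hb1, hb2⟩ := bernoulli_third hp3
  have hd := main_padic hp3 n hn b hb2
  rw [← Ideal.mem_span_singleton, ← PadicInt.norm_le_pow_iff_mem_span_pow, PadicInt.norm_def] at hd
  have h6 : ‖(6 : ℚ_[p])‖ = 1 := by
    have h2 := norm_natCast_of_lt (p := p) (k := 2) (by norm_num) (by omega)
    have h3 := norm_natCast_of_lt (p := p) (k := 3) (by norm_num) (by omega)
    rw [show (6 : ℚ_[p]) = ((2 : ℕ) : ℚ_[p]) * ((3 : ℕ) : ℚ_[p]) by norm_num, norm_mul, h2, h3, one_mul]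
  have e : ((((centralTrinomial (p * n) : ℚ) - centralTrinomial n)
        - (centralTrinomial (n - 1) : ℚ) / 6 * (legendreSym 3 p : ℚ)
            * (Polynomial.bernoulli (p - 2)).eval (1 / 3 : ℚ) * (p * n) ^ 2 : ℚ) : ℚ_[p]) * 6 =
      ((6 * ((centralTrinomial (p * n) : ℤ_[p]) - centralTrinomial n) -
        (centralTrinomial (n - 1) : ℤ_[p]) * (legendreSym 3 (p : ℤ) : ℤ_[p]) * b * (p * n) ^ 2 : ℤ_[p]) : ℚ_[p]) := by
    have e6 : (((6 : ℤ_[p])) : ℚ_[p]) = 6 := by exact_mod_cast PadicInt.coe_natCast (p := p) 6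
    simp only [PadicInt.coe_sub, PadicInt.coe_mul, PadicInt.coe_pow, PadicInt.coe_natCast,
      PadicInt.coe_intCast, e6, hb1, Rat.cast_sub, Rat.cast_mul, Rat.cast_div, Rat.cast_pow,
      Rat.cast_natCast, Rat.cast_intCast, Rat.cast_ofNat]
    ring
  rw [← e, norm_mul, h6, mul_one] at hd
  refine hd.trans (le_of_eq ?_)
  push_cast
  rfl
end

section
/- Let p > 3 be a prime and let n be a positive integer. Then (a_{pn} − a_n)/(pn)^3 is a p-adic integer; equivalently, the p-adic valuation of the integer a_{pn} − a_n is at least 3 + 3ν_p(n), where ν_p(n) is the p-adic valuation of n. -/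
/-- The sequence `a_n = ∑_{k=0}^n C(n,k) C(n-k,k) C(n+k,k)`. -/
def seqA (n : ℕ) : ℕ :=
  ∑ k ∈ Finset.range (n + 1), Nat.choose n k * Nat.choose (n - k) k * Nat.choose (n + k) k

open Finset
theorem facs (i j : ℕ) : (i+j).choose i * i.factorial * j.factorial = (i+j).factorial := by
  have := Nat.choose_mul_factorial_mul_factorial (show i ≤ i + j by omega)
  rwa [Nat.add_sub_cancel_left] at this

theorem vander (m l : ℕ) (N : ℕ) (h : m ≤ N) : ∑ k ∈ range (N+1), m.choose k * l.choose k = (m+l).choose m := by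
  have h1 : ∑ k ∈ range (m+1), m.choose k * l.choose k = (m+l).choose m := by
    rw [Nat.add_comm m l, Nat.add_choose_eq, Nat.sum_antidiagonal_eq_sum_range_succ (fun i j => l.choose i * m.choose j)]
    apply sum_congr rfl
    intro k hk
    rw [Nat.choose_symm (by simp at hk; omega), mul_comm]
  rw [← h1]
  symm
  apply sum_subset
  · intro k; simp; omega
  · intro k _ hk
    simp at hk
    rw [Nat.choose_eq_zero_of_lt (by omega), zero_mul]

theorem vander2 (m l j N : ℕ) (hN : m ≤ N) : ∑ k ∈ range (N+1), m.choose k * l.choose k * k.choose j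
    = m.choose j * (m + l - j).choose m := by
  by_cases hj : m < j
  · rw [Nat.choose_eq_zero_of_lt hj, zero_mul]
    apply sum_eq_zero
    intro k hk
    rcases lt_or_ge m k with h | h
    · rw [Nat.choose_eq_zero_of_lt h]; simp
    · rw [Nat.choose_eq_zero_of_lt (show k < j by omega)]; simp
  by_cases hj2 : l < j
  · rw [Nat.choose_eq_zero_of_lt (show m + l - j < m by omega), mul_zero]
    apply sum_eq_zero
    intro k hk
    rcases lt_or_ge l k with h | h
    · rw [Nat.choose_eq_zero_of_lt h]; simp
    · rw [Nat.choose_eq_zero_of_lt (show k < j by omega)]; simp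
  obtain ⟨a, rfl⟩ : ∃ a, m = j + a := ⟨m - j, by omega⟩
  obtain ⟨M, rfl⟩ : ∃ a, N = j + a := ⟨N - j, by omega⟩
  have e1 : ∀ k, (j+a).choose k * l.choose k * k.choose j = if j ≤ k then (j+a).choose j * (a.choose (k-j) * l.choose k) else 0 := by
    intro k
    split_ifs with h
    · have := @Nat.choose_mul (j+a) k j
      simp only [Nat.add_sub_cancel_left] at this
      by_cases hk : k ≤ j + a
      · have := this h
        linear_combination l.choose k * this
      · rw [Nat.choose_eq_zero_of_lt (show j+a < k by omega), Nat.choose_eq_zero_of_lt (show a < k-j by omega)]; simp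
    · rw [Nat.choose_eq_zero_of_lt (show k < j by omega)]; simp
  simp_rw [e1]
  rw [show j + M + 1 = j + (M + 1) by ring, sum_range_add, sum_eq_zero, zero_add]
  · simp only [Nat.le_add_right, if_true, Nat.add_sub_cancel_left]
    rw [← mul_sum]
    congr 1
    rw [show j + a + l - j = l + a by omega, Nat.add_comm l a]
    rw [show j + a = a + j by ring, ← Nat.choose_symm (show a + j ≤ a + l by omega), show a + l - (a+j) = l - j by omega, Nat.add_comm a l, Nat.add_choose_eq,
      Nat.sum_antidiagonal_eq_sum_range_succ (fun i j => l.choose i * a.choose j)]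
    have : ∀ K, a ≤ K → l - j ≤ K → ∑ x ∈ range (K+1), a.choose x * l.choose (j+x) = ∑ k ∈ range (l-j+1), l.choose k * a.choose (l-j-k) := by
      intro K h1 h2
      rw [← sum_range_reflect (fun k => l.choose k * a.choose (l-j-k))]
      symm
      apply sum_subset_zero_on_sdiff
      · intro k; simp; omega
      · intro x hx
        simp at hx
        rw [Nat.choose_eq_zero_of_lt (show l < j+x by omega), mul_zero]
      · intro x hx
        simp at hx
        rw [mul_comm (a.choose x), ← Nat.choose_symm (show j + x ≤ l by omega)]
        congr 2 <;> omega
    rw [← this (M + (l-j)) (by omega) (by omega)]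
    apply sum_subset
    · intro k; simp; omega
    · intro x _ hx
      simp at hx
      rw [Nat.choose_eq_zero_of_lt (show a < x by omega), zero_mul]
  · intro x hx
    simp at hx
    simp [hx]

theorem keyId (m l N : ℕ) (hN : m ≤ N) : ∑ k ∈ range (N+1), m.choose k * l.choose k * (m+l+k).choose k
   = (m+l).choose m ^ 2 := by
  have e : ∀ k ∈ range (N+1), m.choose k * l.choose k * (m+l+k).choose k = ∑ j ∈ range (N+1), m.choose k * l.choose k * k.choose j * (m+l).choose j := by
    intro k hk
    simp only [mem_range] at hk
    have := vander k (m+l) N (by omega)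
    rw [Nat.add_comm (m+l) k, ← this, mul_sum]
    simp only [mul_assoc]
  rw [sum_congr rfl e, sum_comm]
  simp_rw [← sum_mul]
  have e2 : ∀ j, (m.choose j * (m + l - j).choose m) * (m+l).choose j = (m+l).choose m * (m.choose j * l.choose j) := by
    intro j
    by_cases h : j ≤ l
    · obtain ⟨b, rfl⟩ := Nat.exists_eq_add_of_le h
      have h1 := facs m (j+b)
      have h2 := facs j b
      have h3 := facs m b
      have h4 := facs j (m+b)
      rw [show m + (j+b) - j = m + b by omega]
      rw [show j + (m+b) = m + (j+b) by ring] at h4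
      have : (m+b).choose m * (m+(j+b)).choose j = (m+(j+b)).choose m * (j+b).choose j := by
        have hpos : 0 < m.factorial * j.factorial * b.factorial := by positivity
        apply Nat.eq_of_mul_eq_mul_right hpos
        calc _ = ((m+(j+b)).choose j) * j.factorial * ((m+b).choose m * m.factorial * b.factorial) := by ring
          _ = (m+(j+b)).factorial := by rw [h3, h4]
          _ = (m+(j+b)).choose m * m.factorial * ((j+b).choose j * j.factorial * b.factorial) := by rw [h2, h1]
          _ = _ := by ring
      linear_combination m.choose j * this
    · rw [Nat.choose_eq_zero_of_lt (show l < j by omega)]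
      by_cases hm : j ≤ m
      · rw [Nat.choose_eq_zero_of_lt (show m + l - j < m by omega)]; simp
      · rw [Nat.choose_eq_zero_of_lt (show m < j by omega)]; simp
  simp_rw [vander2 m l _ N hN, e2]
  rw [← mul_sum, vander m l N hN, sq]

theorem multi (k i j : ℕ) : (2*k+(i+j)).choose (k+i) * (k+i).choose k * (k+j).choose k
   = (2*k+(i+j)).choose k * (k+(i+j)).choose k * (i+j).choose i := by
  have h1 := facs (k+i) (k+j)
  have h2 := facs k i
  have h3 := facs k j
  have h4 := facs k (k+(i+j))
  have h5 := facs k (i+j)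
  have h6 := facs i j
  rw [show k+i+(k+j) = 2*k+(i+j) by ring] at h1
  rw [show k+(k+(i+j)) = 2*k+(i+j) by ring] at h4
  have hpos : 0 < k.factorial * i.factorial * (k.factorial * j.factorial) := by positivity
  apply Nat.eq_of_mul_eq_mul_right hpos
  calc _ = (2*k+(i+j)).choose (k+i) * ((k+i).choose k * k.factorial * i.factorial) * ((k+j).choose k * k.factorial * j.factorial) := by ring
    _ = (2*k+(i+j)).factorial := by rw [h2, h3, h1]
    _ = (2*k+(i+j)).choose k * k.factorial * ((k+(i+j)).choose k * k.factorial * ((i+j).choose i * i.factorial * j.factorial)) := by rw [h6, h5, h4]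
    _ = _ := by ring

theorem inner {R : Type*} [CommRing R] (x y : R) (hxy : x * y = 1) (hs : x + y = 1) (n k : ℕ) :
    ∑ m ∈ range (n+1), ((n.choose m * m.choose k * (n-m).choose k : ℕ) : R) * (x^m*y^(n-m))
     = ((n.choose k * (n-k).choose k : ℕ) : R) := by
  by_cases h : 2 * k ≤ n
  · obtain ⟨e, rfl⟩ := Nat.exists_eq_add_of_le h
    rw [show 2*k+e+1 = k + ((e+1) + k) by ring, sum_range_add, sum_range_add, sum_eq_zero, zero_add]
    rotate_left
    · intro m hm
      simp only [mem_range] at hm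
      rw [Nat.choose_eq_zero_of_lt hm]; simp
    have : ∑ m ∈ range k, (((2*k+e).choose (k+(e+1+m)) * (k+(e+1+m)).choose k * (2*k+e-(k+(e+1+m))).choose k : ℕ) : R) * (x^(k+(e+1+m))*y^(2*k+e-(k+(e+1+m)))) = 0 := by
      apply sum_eq_zero
      intro m hm
      simp only [mem_range] at hm
      rw [Nat.choose_eq_zero_of_lt (show 2*k+e-(k+(e+1+m)) < k by omega)]; simp
    rw [this, add_zero]
    have e3 : ∀ i ∈ range (e+1), (((2*k+e).choose (k+i) * (k+i).choose k * (2*k+e-(k+i)).choose k : ℕ) : R) * (x^(k+i)*y^(2*k+e-(k+i))) = (((2*k+e).choose k * (2*k+e-k).choose k : ℕ) : R) * (x^i*y^(e-i)*(e.choose i : R)) := by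
      intro i hi
      simp only [mem_range] at hi
      obtain ⟨j, rfl⟩ := Nat.exists_eq_add_of_le (show i ≤ e by omega)
      rw [show 2*k+(i+j)-(k+i) = k+j by omega, show 2*k+(i+j)-k = k+(i+j) by omega, multi, Nat.add_sub_cancel_left]
      have : x^(k+i)*y^(k+j) = x^i*y^j := by
        rw [pow_add, pow_add, show x^k*x^i*(y^k*y^j) = (x*y)^k*(x^i*y^j) by rw [mul_pow]; ring, hxy]; simp
      rw [this]
      push_cast
      ring
    rw [sum_congr rfl e3, ← mul_sum, ← add_pow, hs]; simp
  · have : n.choose k * (n-k).choose k = 0 := by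
      rw [Nat.choose_eq_zero_of_lt (show n - k < k by omega)]; simp
    rw [this, Nat.cast_zero]
    apply sum_eq_zero
    intro m _
    rcases lt_or_ge m k with h' | h'
    · rw [Nat.choose_eq_zero_of_lt h']; simp
    · rw [Nat.choose_eq_zero_of_lt (show n - m < k by omega)]; simp

theorem seqA_eq {R : Type*} [CommRing R] (x y : R) (hxy : x * y = 1) (hs : x + y = 1) (n : ℕ) :
    (seqA n : R) = ∑ m ∈ range (n+1), (n.choose m : R)^3 * (x^m*y^(n-m)) := by
  unfold seqA
  push_cast
  have : ∀ m ∈ range (n+1), (n.choose m : R)^3 * (x^m*y^(n-m)) = ∑ k ∈ range (n+1), ((n.choose m * m.choose k * (n-m).choose k : ℕ) : R) * (x^m*y^(n-m)) * ((n+k).choose k : R) := by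
    intro m hm
    simp only [mem_range] at hm
    have := keyId m (n-m) n (by omega)
    rw [show m + (n-m) = n by omega] at this
    have h2 := congrArg (Nat.cast : ℕ → R) this
    push_cast at h2
    rw [pow_succ', ← h2, mul_sum, sum_mul]
    apply sum_congr rfl
    intros
    push_cast
    ring
  rw [sum_congr rfl this, sum_comm]
  apply sum_congr rfl
  intro k _
  rw [← sum_mul, inner x y hxy hs]
  push_cast; rfl

/-- product of `A + j` over `j < K` prime to `p` -/
def NN (p A K : ℕ) : ℕ := ∏ j ∈ range K, if p ∣ j then 1 else A + j

theorem fac_mul (p : ℕ) (hp : 0 < p) (k : ℕ) : (p*k).factorial = p^k * k.factorial * NN p 0 (p*k) := by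
  induction k with
  | zero => simp [NN]
  | succ k ih =>
    have e1 : (p*(k+1)).factorial = (p*k).factorial * ∏ i ∈ range p, (p*k+i+1) := by
      rw [← prod_range_add_one_eq_factorial, ← prod_range_add_one_eq_factorial, mul_add, mul_one, prod_range_add]
    have e2 : NN p 0 (p*(k+1)) = NN p 0 (p*k) * ∏ i ∈ range p, (if p ∣ p*k+i then 1 else p*k+i) := by
      unfold NN
      rw [mul_add, mul_one, prod_range_add]
      simp
    obtain ⟨q, rfl⟩ : ∃ q, p = q+1 := ⟨p-1, by omega⟩
    have e3 : ∏ i ∈ range (q+1), (if (q+1) ∣ (q+1)*k+i then 1 else (q+1)*k+i) = ∏ i ∈ range q, ((q+1)*k+i+1) := by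
      rw [prod_range_succ']
      simp only [add_zero, dvd_mul_right, if_true, mul_one]
      apply prod_congr rfl
      intro i hi
      simp only [mem_range] at hi
      rw [if_neg, add_assoc]
      rw [Nat.dvd_add_right (dvd_mul_right _ _)]
      intro h
      have := Nat.le_of_dvd (by omega) h
      omega
    rw [e1, e2, e3, ih, prod_range_succ, Nat.factorial_succ, pow_succ]
    ring

theorem NN_pos (p A K : ℕ) : 0 < NN p A K := by
  apply prod_pos
  intro j _
  split_ifs with h
  · simp
  · have : j ≠ 0 := by rintro rfl; simp at h
    omega

theorem NN_add (p m k : ℕ) : NN p 0 (p*(m+k)) = NN p 0 (p*m) * NN p (p*m) (p*k) := by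
  unfold NN
  rw [mul_add, prod_range_add]
  congr 1
  apply prod_congr rfl
  intro j _
  simp [Nat.dvd_add_right (dvd_mul_right p m)]

theorem choose_NN (p : ℕ) (hp : 0 < p) (m k : ℕ) :
    (p*(m+k)).choose (p*k) * NN p 0 (p*k) = (m+k).choose k * NN p (p*m) (p*k) := by
  have h1 := Nat.add_choose_mul_factorial_mul_factorial (p*m) (p*k)
  have h2 := Nat.add_choose_mul_factorial_mul_factorial m k
  rw [← mul_add, fac_mul p hp m, fac_mul p hp k, fac_mul p hp (m+k), NN_add, ← h2] at h1
  have hpos : 0 < p^(m+k) * m.factorial * k.factorial * NN p 0 (p*m) := by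
    have := NN_pos p 0 (p*m)
    positivity
  apply Nat.eq_of_mul_eq_mul_right hpos
  rw [pow_add] at *
  linear_combination h1

theorem NN_coprime (p A K : ℕ) (hp : p.Prime) (hA : p ∣ A) : (NN p A K).Coprime p := by
  apply Nat.Coprime.prod_left
  intro j _
  split_ifs with h
  · simp
  · rw [Nat.coprime_comm, Nat.Prime.coprime_iff_not_dvd hp, Nat.dvd_add_right hA]
    exact h

theorem sum_inv_all (q : ℕ) [NeZero q] (h6 : q.Coprime 6) : ∑ z : ZMod q, (Ring.inverse z)^2 = 0 := by
  have h2 : IsUnit (2 : ZMod q) := by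
    have := (ZMod.isUnit_iff_coprime 2 q).2 (Nat.Coprime.symm (Nat.Coprime.coprime_dvd_right (by norm_num) h6))
    simpa using this
  have h3 : IsUnit (3 : ZMod q) := by
    have := (ZMod.isUnit_iff_coprime 3 q).2 (Nat.Coprime.symm (Nat.Coprime.coprime_dvd_right (by norm_num) h6))
    simpa using this
  have e : ∑ z : ZMod q, (Ring.inverse (2*z))^2 = ∑ z : ZMod q, (Ring.inverse z)^2 := by
    obtain ⟨u, hu⟩ := h2
    rw [← hu]
    exact Equiv.sum_comp (Units.mulLeft u) (fun z => (Ring.inverse z)^2)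
  simp_rw [Ring.mul_inverse_rev, mul_pow] at e
  rw [← sum_mul] at e
  have h4 : (2 : ZMod q) * Ring.inverse 2 = 1 := Ring.mul_inverse_cancel _ h2
  set S := ∑ z : ZMod q, (Ring.inverse z)^2
  have : 3 * S = 0 := by
    linear_combination -4 * e + S * (2 * Ring.inverse 2 + 1) * h4
  exact (h3.mul_right_eq_zero).1 this

theorem sum_inv (q : ℕ) [NeZero q] (h6 : q.Coprime 6) (c : ℕ) :
    ∑ j ∈ range (q*c), (Ring.inverse (j : ZMod q))^2 = 0 := by
  induction c with
  | zero => simp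
  | succ c ih =>
    rw [mul_add, mul_one, sum_range_add, ih, zero_add]
    simp only [Nat.cast_add, Nat.cast_mul, CharP.cast_eq_zero, zero_mul, zero_add]
    rw [← sum_inv_all q h6]
    apply sum_bij (fun (j : ℕ) _ => (j : ZMod q))
    · simp
    · intro a ha b hb h
      simp only [mem_range] at ha hb
      have := congrArg ZMod.val h
      rwa [ZMod.val_cast_of_lt ha, ZMod.val_cast_of_lt hb] at this
    · intro b _
      exact ⟨b.val, by simpa using ZMod.val_lt b, by simp⟩
    · simp

theorem prod_one_add {R ι : Type*} [CommRing R] [DecidableEq ι] (c : R) (hc : c * c = 0) (u : ι → R) (s : Finset ι) :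
    ∏ j ∈ s, (1 + c * u j) = 1 + c * ∑ j ∈ s, u j := by
  induction s using Finset.induction_on with
  | empty => simp
  | insert a s ha ih =>
    rw [prod_insert ha, sum_insert ha, ih]
    linear_combination (u a * ∑ j ∈ s, u j) * hc

theorem NN_filter {R : Type*} [CommRing R] (p A K : ℕ) :
    (NN p A K : R) = ∏ j ∈ (range K).filter (fun j => ¬ p ∣ j), ((A : R) + j) := by
  unfold NN
  rw [prod_filter]
  push_cast
  simp only [ite_not]

theorem NN_reflect {R : Type*} [CommRing R] (p A K : ℕ) (hK : p ∣ K) :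
    (NN p A K : R) = ∏ j ∈ (range K).filter (fun j => ¬ p ∣ j), ((A : R) + K - j) := by
  rw [NN_filter]
  have hm : ∀ a, a < K → ¬ p ∣ a → K - a < K ∧ ¬ p ∣ K - a := by
    intro a h1 h2
    have : a ≠ 0 := by rintro rfl; simp at h2
    refine ⟨by omega, fun h => h2 ?_⟩
    exact (Nat.dvd_sub_iff_right h1.le hK).1 h
  apply prod_bij' (fun j _ => K - j) (fun j _ => K - j)
  · intro a ha
    simp only [mem_filter, mem_range] at ha ⊢
    exact hm a ha.1 ha.2
  · intro a ha
    simp only [mem_filter, mem_range] at ha ⊢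
    exact hm a ha.1 ha.2
  · intro a ha
    simp only [mem_filter, mem_range] at ha ⊢
    omega
  · intro a ha
    simp only [mem_filter, mem_range] at ha ⊢
    omega
  · intro a ha
    simp only [mem_filter, mem_range] at ha ⊢
    rw [Nat.cast_sub ha.1.le]
    ring

theorem NN_congr (p r : ℕ) (hp : p.Prime) (hp3 : 3 < p) (A K : ℕ) (hA : p^(r+1) ∣ A) (hK : p^(r+1) ∣ K) :
    ((p:ℤ)^(r+1))^3 ∣ (NN p A K : ℤ) - NN p 0 K := by
  set q := p^(r+1) with hq
  have hpq : p ∣ q := dvd_pow_self p (by omega)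
  have hpK : p ∣ K := hpq.trans hK
  have hpA : p ∣ A := hpq.trans hA
  have hq0 : 0 < q := pow_pos hp.pos _
  have : NeZero q := ⟨hq0.ne'⟩
  have : NeZero (q^3) := ⟨(pow_pos hq0 3).ne'⟩
  have h6 : q.Coprime 6 := by
    apply Nat.Coprime.pow_left
    rw [Nat.Prime.coprime_iff_not_dvd hp]
    intro h
    have := Nat.le_of_dvd (by norm_num) h
    interval_cases p <;> revert hp h <;> decide
  have hun : ∀ M : ℕ, ∀ j : ℕ, M ∣ q ^ 3 → ¬ p ∣ j → IsUnit (j : ZMod M) := by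
    intro M j hM hj
    rw [ZMod.isUnit_iff_coprime]
    apply Nat.Coprime.coprime_dvd_right hM
    apply Nat.Coprime.pow_right
    apply Nat.Coprime.pow_right
    exact ((Nat.Prime.coprime_iff_not_dvd hp).2 hj).symm
  set T := (range K).filter (fun j => ¬ p ∣ j) with hT
  have hKj : ∀ j ∈ T, ¬ p ∣ K - j := by
    intro j hj h
    simp only [hT, mem_filter, mem_range] at hj
    exact hj.2 ((Nat.dvd_sub_iff_right hj.1.le hpK).1 h)
  let u : ℕ → (ZMod (q^3)) := fun j => Ring.inverse ((j : (ZMod (q^3))) * ((K - j : ℕ) : (ZMod (q^3))))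
  have hu : ∀ j ∈ T, ((j : (ZMod (q^3))) * ((K : (ZMod (q^3))) - j)) * u j = 1 := by
    intro j hj
    have h1 : j ≤ K := by simp only [hT, mem_filter, mem_range] at hj; omega
    have h2 : ¬ p ∣ j := by simp only [hT, mem_filter, mem_range] at hj; exact hj.2
    have := Ring.mul_inverse_cancel ((j : (ZMod (q^3))) * ((K - j : ℕ) : (ZMod (q^3)))) ((hun (q^3) j dvd_rfl h2).mul (hun (q^3) (K-j) dvd_rfl (hKj j hj)))
    rw [← this]
    simp only [u]
    rw [Nat.cast_sub h1]
  set c : (ZMod (q^3)) := (A : ZMod (q^3)) * ((A : ZMod (q^3)) + (K : ZMod (q^3))) with hc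
  have hq3 : (q : (ZMod (q^3)))^3 = 0 := by
    have := ZMod.natCast_self (q^3)
    push_cast at this
    exact this
  obtain ⟨a, ha⟩ := hA
  obtain ⟨b, hb⟩ := hK
  have hAq : (A : (ZMod (q^3))) = q * a := by rw [ha]; push_cast; ring
  have hKq : (K : (ZMod (q^3))) = q * b := by rw [hb]; push_cast; ring
  have hcq : c = q^2 * (a * (a + b)) := by rw [hc, hAq, hKq]; ring
  have hcc : c * c = 0 := by
    rw [hcq]
    linear_combination (q : (ZMod (q^3))) * (a * (a + b))^2 * hq3
  -- the sum vanishes modulo q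
  let φ : (ZMod (q^3)) →+* ZMod q := ZMod.castHom (dvd_pow_self q (by norm_num)) (ZMod q)
  have hφ : φ (∑ j ∈ T, u j) = 0 := by
    rw [map_sum]
    have : ∀ j ∈ T, φ (u j) = - (Ring.inverse (j : ZMod q))^2 := by
      intro j hj
      have h2 : ¬ p ∣ j := by simp only [hT, mem_filter, mem_range] at hj; exact hj.2
      have h1 := congrArg φ (hu j hj)
      simp only [map_mul, map_sub, map_natCast, map_one] at h1
      rw [show (K : ZMod q) = 0 by rw [hb]; simp] at h1
      have h3 := Ring.mul_inverse_cancel _ (hun q j (dvd_pow_self q (by norm_num)) h2)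
      linear_combination -(Ring.inverse (j : ZMod q))^2 * h1 - φ (u j) * (1 + (j : ZMod q) * Ring.inverse (j : ZMod q)) * h3
    rw [sum_congr rfl this, sum_neg_distrib, neg_eq_zero, ← sum_inv q h6 b, ← hb]
    apply sum_subset (filter_subset _ _)
    intro j hj hjT
    have h1 : p ∣ j := by
      by_contra h
      exact hjT (mem_filter.2 ⟨hj, h⟩)
    rw [Ring.inverse_non_unit, sq, mul_zero]
    rw [ZMod.isUnit_iff_coprime]
    exact Nat.not_coprime_of_dvd_of_dvd hp.one_lt h1 hpq
  have hcS : c * ∑ j ∈ T, u j = 0 := by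
    obtain ⟨w, hw⟩ := ZMod.natCast_zmod_surjective (∑ j ∈ T, u j)
    rw [← hw] at hφ ⊢
    rw [map_natCast, ZMod.natCast_eq_zero_iff] at hφ
    obtain ⟨v, rfl⟩ := hφ
    rw [hcq]
    push_cast
    linear_combination (a * (a + b) * v : (ZMod (q^3))) * hq3
  have hsq : (NN p A K : (ZMod (q^3)))^2 = (NN p 0 K : (ZMod (q^3)))^2 := by
    have e1 : (NN p A K : (ZMod (q^3)))^2 = ∏ j ∈ T, ((j : (ZMod (q^3))) * (K - j) * (1 + c * u j)) := by
      rw [sq]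
      nth_rewrite 1 [NN_filter]
      rw [NN_reflect p A K hpK, ← prod_mul_distrib]
      apply prod_congr rfl
      intro j hj
      linear_combination - c * hu j hj
    have e2 : (NN p 0 K : (ZMod (q^3)))^2 = ∏ j ∈ T, ((j : (ZMod (q^3))) * (K - j)) := by
      rw [sq]
      nth_rewrite 1 [NN_filter]
      rw [NN_reflect p 0 K hpK, ← prod_mul_distrib]
      apply prod_congr rfl
      intro j hj
      push_cast
      ring
    rw [e1, prod_mul_distrib, prod_one_add c hcc, hcS, ← e2]
    simp
  have hU : IsUnit ((NN p A K : (ZMod (q^3))) + NN p 0 K) := by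
    have : ¬ p ∣ NN p A K + NN p 0 K := by
      intro h
      have hd : ((NN p A K : ℕ) : ZMod p) = NN p 0 K := by
        rw [NN_filter, NN_filter]
        simp [(ZMod.natCast_eq_zero_iff A p).2 hpA]
      have h' := (ZMod.natCast_eq_zero_iff _ p).2 h
      rw [Nat.cast_add, hd, ← two_mul] at h'
      have h2 : p ∣ 2 * NN p 0 K := by
        rw [← ZMod.natCast_eq_zero_iff]; push_cast; exact h'
      rcases (Nat.Prime.dvd_mul hp).1 h2 with h | h
      · have := Nat.le_of_dvd (by norm_num) h; omega
      · exact ((Nat.Prime.coprime_iff_not_dvd hp).1 (NN_coprime p 0 K hp (dvd_zero p)).symm) h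
    have := hun (q^3) _ dvd_rfl this
    simpa using this
  have hfin : (NN p A K : (ZMod (q^3))) - NN p 0 K = 0 := by
    apply (hU.mul_right_eq_zero).1
    linear_combination hsq
  have : (((NN p A K : ℤ) - NN p 0 K : ℤ) : ZMod (q^3)) = 0 := by
    push_cast; exact hfin
  rw [ZMod.intCast_zmod_eq_zero_iff_dvd] at this
  push_cast [hq] at this
  exact this

theorem choose_dvd (p s t n k : ℕ) (hp : p.Prime) (hn : p^s ∣ n) (hk : ¬ p^(t+1) ∣ k) :
    p^(s-t) ∣ n.choose k := by
  rcases Nat.lt_or_ge s t with h | h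
  · rw [Nat.sub_eq_zero_of_le h.le]; simp
  have hk0 : k ≠ 0 := by rintro rfl; simp at hk
  rcases Nat.eq_zero_or_pos n with rfl | hn0
  · rw [Nat.choose_eq_zero_of_lt (by omega)]; simp
  obtain ⟨k', rfl⟩ : ∃ k', k = k' + 1 := ⟨k-1, by omega⟩
  obtain ⟨n', rfl⟩ : ∃ n', n = n' + 1 := ⟨n-1, by omega⟩
  have h1 : p^s ∣ (n'+1).choose (k'+1) * (k'+1) := by
    rw [← Nat.add_one_mul_choose_eq]
    exact hn.mul_right _
  by_contra hc
  have h2 : p^(s-t) * p^t ∣ (n'+1).choose (k'+1) * (k'+1) := by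
    rw [← pow_add, show s - t + t = s by omega]; exact h1
  rcases Nat.eq_zero_or_pos (s-t) with h0 | h0
  · rw [h0] at hc; simp at hc
  have hC : (n'+1).choose (k'+1) = 0 ∨ (n'+1).choose (k'+1) ≠ 0 := eq_or_ne _ _
  rcases hC with hC | hC
  · rw [hC] at hc; simp at hc
  have := Fact.mk hp
  have v1 := (padicValNat_dvd_iff_le (p := p) (n := s) (mul_ne_zero hC hk0)).1 h1
  rw [padicValNat.mul hC hk0] at v1
  have v2 := mt (padicValNat_dvd_iff_le (p := p) hC).2 hc
  have v3 := mt (padicValNat_dvd_iff_le (p := p) hk0).2 hk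
  omega

theorem choose_cube (p s n k : ℕ) (hp : p.Prime) (hp3 : 3 < p) (hn : p^s ∣ n) (hk : k ≤ n) :
    (p:ℤ)^(3*(s+1)) ∣ ((p*n).choose (p*k) : ℤ)^3 - (n.choose k : ℤ)^3 := by
  obtain ⟨r, hrs, hr, hd⟩ : ∃ r ≤ s, p^r ∣ k ∧ p^(s-r) ∣ n.choose k := by
    by_cases h : p^s ∣ k
    · exact ⟨s, le_rfl, h, by simp⟩
    · have hk0 : k ≠ 0 := by rintro rfl; simp at h
      have := Fact.mk hp
      have h1 := mt (padicValNat_dvd_iff_le (p := p) hk0).2 h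
      refine ⟨padicValNat p k, by omega, pow_padicValNat_dvd, ?_⟩
      exact choose_dvd p s _ n k hp hn (pow_succ_padicValNat_not_dvd hk0)
  obtain ⟨m, rfl⟩ : ∃ m, n = m + k := ⟨n - k, by omega⟩
  have hm : p^r ∣ m := (Nat.dvd_add_left hr).1 ((pow_dvd_pow p hrs).trans hn)
  have hN := NN_congr p r hp hp3 (p*m) (p*k) (by rw [pow_succ']; exact mul_dvd_mul_left p hm)
    (by rw [pow_succ']; exact mul_dvd_mul_left p hr)
  have hC := congrArg (Nat.cast : ℕ → ℤ) (choose_NN p hp.pos m k)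
  push_cast at hC
  have hcop : IsCoprime ((p:ℤ)^(3*(s+1))) ((NN p 0 (p*k) : ℤ)^3) := by
    apply IsCoprime.pow
    exact Nat.isCoprime_iff_coprime.2 (NN_coprime p 0 (p*k) hp (dvd_zero p)).symm
  apply hcop.dvd_of_dvd_mul_right
  set D : ℤ := (NN p 0 (p*k) : ℤ)
  set N : ℤ := (NN p (p*m) (p*k) : ℤ)
  set C : ℤ := ((m+k).choose k : ℤ)
  set C' : ℤ := ((p*(m+k)).choose (p*k) : ℤ)
  have e : (C'^3 - C^3) * D^3 = C^3 * (N^3 - D^3) := by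
    have : (C'*D)^3 = (C*N)^3 := by rw [hC]
    linear_combination this
  rw [e, show 3*(s+1) = (s-r)*3 + (r+1)*3 by omega, pow_add]
  apply mul_dvd_mul
  · rw [pow_mul]
    apply pow_dvd_pow_of_dvd
    have := Int.natCast_dvd_natCast.2 hd
    push_cast at this
    exact this
  · rw [pow_mul]
    exact hN.trans (sub_dvd_pow_sub_pow N D 3)

theorem sum_mult {R : Type*} [AddCommMonoid R] (p n : ℕ) (hp : 0 < p) (f : ℕ → R) :
    ∑ m ∈ (range (p*n+1)).filter (fun m => p ∣ m), f m = ∑ k ∈ range (n+1), f (p*k) := by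
  symm
  apply sum_bij (fun k _ => p*k)
  · intro a ha
    simp only [mem_range, mem_filter] at ha ⊢
    exact ⟨Nat.lt_succ_of_le (Nat.mul_le_mul_left p (by omega)), dvd_mul_right _ _⟩
  · intro a _ b _ h
    exact Nat.eq_of_mul_eq_mul_left hp h
  · intro b hb
    simp only [mem_range, mem_filter] at hb
    obtain ⟨h, c, rfl⟩ := hb
    exact ⟨c, by simp only [mem_range]; exact Nat.lt_succ_of_le (Nat.le_of_mul_le_mul_left (by omega) hp), rfl⟩
  · intros; rfl

theorem main_dvd {R : Type*} [CommRing R] (x y : R) (hxy : x * y = 1) (hs : x + y = 1)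
    (p s n : ℕ) (hp : p.Prime) (hp3 : 3 < p) (hn : p^s ∣ n) :
    (p:R)^(3*(s+1)) ∣ (seqA (p*n) : R) - seqA n := by
  have hXY : x^p * y^p = 1 := by rw [← mul_pow, hxy, one_pow]
  have hS : x^p + y^p = 1 := by
    have hy : y = 1 - x := by linear_combination hs
    have hx2 : x^2 = x - 1 := by rw [hy] at hxy; linear_combination -hxy
    have hx3 : x^3 = -1 := by linear_combination (x + 1) * hx2
    have hy3 : y^3 = -1 := by rw [hy]; linear_combination (2 - x) * hx2
    have hx6 : x^6 = 1 := by linear_combination (x^3 - 1) * hx3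
    have hy6 : y^6 = 1 := by linear_combination (y^3 - 1) * hy3
    have hmod : p % 6 = 1 ∨ p % 6 = 5 := by
      have h2 : ¬ 2 ∣ p := fun h => by
        have := (Nat.prime_dvd_prime_iff_eq Nat.prime_two hp).1 h; omega
      have h3 : ¬ 3 ∣ p := fun h => by
        have := (Nat.prime_dvd_prime_iff_eq Nat.prime_three hp).1 h; omega
      omega
    rw [← Nat.div_add_mod p 6, pow_add, pow_add, pow_mul, pow_mul, hx6, hy6, one_pow, one_mul, one_mul]
    rcases hmod with h | h <;> rw [h]
    · simpa using hs
    · have e1 : x^5 = y := by linear_combination x^2 * hx3 - hx2 - hy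
      have e2 : y^5 = x := by
        have hy2 : y^2 = y - 1 := by rw [hy]; linear_combination hx2
        linear_combination y^2 * hy3 - hy2 - hy
      rw [e1, e2]; linear_combination hs
  rw [seqA_eq x y hxy hs (p*n), seqA_eq (x^p) (y^p) hXY hS n,
    ← sum_filter_add_sum_filter_not _ (fun m => p ∣ m), sum_mult p n hp.pos, add_sub_right_comm,
    ← sum_sub_distrib]
  apply dvd_add
  · apply dvd_sum
    intro k hk
    simp only [mem_range] at hk
    have h := choose_cube p s n k hp hp3 hn (by omega)
    have h2 := map_dvd (Int.castRingHom R) h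
    simp only [eq_intCast] at h2
    push_cast at h2
    rw [← pow_mul, ← pow_mul, ← Nat.mul_sub, ← sub_mul]
    exact h2.mul_right _
  · apply dvd_sum
    intro m hm
    simp only [mem_filter] at hm
    have h := choose_dvd p (s+1) 0 (p*n) m hp (by rw [pow_succ']; exact mul_dvd_mul_left p hn) (by simpa using hm.2)
    have h2 := map_dvd (Nat.castRingHom R) h
    simp only [eq_natCast] at h2
    push_cast at h2
    apply Dvd.dvd.mul_right
    rw [mul_comm 3, pow_mul]
    exact pow_dvd_pow_of_dvd h2 3

theorem seqA_supercongruence (p : ℕ) (hp : p.Prime) (hp3 : 3 < p)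
    (n : ℕ) (hn : 0 < n) :
    (p : ℤ) ^ (3 + 3 * padicValNat p n) ∣ (seqA (p * n) : ℤ) - seqA n := by
  have h := main_dvd (R := QuadraticAlgebra ℤ (-1) 1) ⟨0, 1⟩ ⟨1, -1⟩
    (by ext <;> simp <;> rfl) (by ext <;> simp <;> rfl) p (padicValNat p n) n hp hp3 pow_padicValNat_dvd
  obtain ⟨c, hc⟩ := h
  refine ⟨c.re, ?_⟩
  have h1 := congrArg QuadraticAlgebra.re hc
  rw [show (p : QuadraticAlgebra ℤ (-1) 1)^(3*(padicValNat p n + 1)) = (((p:ℤ)^(3 + 3 * padicValNat p n) : ℤ) : QuadraticAlgebra ℤ (-1) 1) by push_cast; ring_nf] at h1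
  rw [QuadraticAlgebra.re_mul, QuadraticAlgebra.re_intCast, QuadraticAlgebra.im_intCast] at h1
  simpa using h1
end

section
/- Let p > 3 be a prime, n a positive integer, and k an integer with 0 ≤ k ≤ n. Then C(pn,pk)^2 ≡ C(n,k)^2 (mod p^{3+3ν_p(n)}) and C(pn,pk)^3 ≡ C(n,k)^3 (mod p^{3+3ν_p(n)}), where ν_p(n) is the p-adic valuation of n. -/
def jacS (p k : ℕ) : Finset ℕ := (Finset.range (p * k)).filter (fun i => ¬ p ∣ i)

lemma jac_reflect {M : Type*} [CommMonoid M] (p k : ℕ) (g : ℕ → M) :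
    ∏ i ∈ jacS p k, g (p * k - i) = ∏ i ∈ jacS p k, g i := by
  have key : ∀ i ∈ jacS p k, p * k - i ∈ jacS p k := by
    intro i hi
    simp only [jacS, Finset.mem_filter, Finset.mem_range] at hi ⊢
    have h0 : i ≠ 0 := by
      rintro rfl
      exact hi.2 (dvd_zero p)
    refine ⟨by omega, fun h => hi.2 ?_⟩
    have := Nat.dvd_sub (Dvd.intro k rfl) h
    rwa [Nat.sub_sub_self hi.1.le] at this
  have key2 : ∀ i ∈ jacS p k, p * k - (p * k - i) = i := by
    intro i hi
    simp only [jacS, Finset.mem_filter, Finset.mem_range] at hi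
    omega
  refine Finset.prod_nbij' (fun i => p * k - i) (fun i => p * k - i) key key key2 key2 ?_
  intro i hi
  rfl

lemma jac_split {M : Type*} [CommMonoid M] (p k : ℕ) (hp : 0 < p) (g : ℕ → M) :
    ∏ i ∈ Finset.range (p * k), g i
      = (∏ j ∈ Finset.range k, g (p * j)) * ∏ i ∈ jacS p k, g i := by
  rw [← Finset.prod_filter_mul_prod_filter_not (Finset.range (p * k)) (fun i => p ∣ i)]
  congr 1
  symm
  refine Finset.prod_nbij' (fun j => p * j) (fun i => i / p) ?_ ?_ ?_ ?_ ?_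
  · intro j hj
    simp only [Finset.mem_filter, Finset.mem_range] at hj ⊢
    exact ⟨Nat.mul_lt_mul_of_pos_left hj hp, Dvd.intro j rfl⟩
  · intro i hi
    simp only [Finset.mem_filter, Finset.mem_range] at hi ⊢
    exact Nat.div_lt_of_lt_mul hi.1
  · intro j _
    exact Nat.mul_div_cancel_left j hp
  · intro i hi
    simp only [Finset.mem_filter, Finset.mem_range] at hi
    exact Nat.mul_div_cancel' hi.2
  · intro j _
    rfl

lemma jac_desc (p n k : ℕ) (hp : 0 < p) :
    (p * n).descFactorial (p * k)
      = p ^ k * n.descFactorial k * ∏ i ∈ jacS p k, (p * n - i) := by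
  rw [Nat.descFactorial_eq_prod_range, jac_split p k hp, Nat.descFactorial_eq_prod_range]
  congr 1
  rw [← Finset.card_range k, ← Finset.prod_const, Finset.card_range, ← Finset.prod_mul_distrib]
  refine Finset.prod_congr rfl fun j _ => ?_
  rw [Nat.mul_sub]

lemma jac_choose (p n k : ℕ) (hp : 0 < p) :
    (p * n).choose (p * k) * ∏ i ∈ jacS p k, (p * k - i)
      = n.choose k * ∏ i ∈ jacS p k, (p * n - i) := by
  have h1 := jac_desc p n k hp
  have h2 := jac_desc p k k hp
  rw [Nat.descFactorial_eq_factorial_mul_choose, Nat.descFactorial_eq_factorial_mul_choose] at h1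
  rw [Nat.descFactorial_self, Nat.descFactorial_self] at h2
  have h3 : 0 < p ^ k * k.factorial := by positivity
  apply Nat.eq_of_mul_eq_mul_left h3
  rw [h2] at h1
  linear_combination h1

lemma jac_expand {N : ℕ} (s : Finset ℕ) (x : ℕ → ℤ) (t : ℤ)
    (hx : ∀ i ∈ s, IsUnit ((x i : ℤ) : ZMod N)) :
    ∃ e r : ℤ, ∏ i ∈ s, (x i + t) = ∏ i ∈ s, x i + t * e + t ^ 2 * r ∧
      ((e : ℤ) : ZMod N) = (∏ i ∈ s, ((x i : ℤ) : ZMod N))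
        * ∑ i ∈ s, Ring.inverse ((x i : ℤ) : ZMod N) := by
  classical
  induction s using Finset.induction_on with
  | empty => exact ⟨0, 0, by simp, by simp⟩
  | insert a s ha ih =>
    obtain ⟨e, r, h1, h2⟩ := ih fun i hi => hx i (Finset.mem_insert_of_mem hi)
    refine ⟨x a * e + ∏ i ∈ s, x i, x a * r + e + t * r, ?_, ?_⟩
    · rw [Finset.prod_insert ha, Finset.prod_insert ha, h1]
      ring
    · rw [Finset.prod_insert ha, Finset.sum_insert ha]
      have hu := Ring.mul_inverse_cancel _ (hx a (Finset.mem_insert_self a s))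
      push_cast
      rw [h2]
      linear_combination (-∏ i ∈ s, ((x i : ℤ) : ZMod N)) * hu

lemma jac_sum_period {M : Type*} [AddCommMonoid M] (N q : ℕ) [NeZero N] (g : ZMod N → M) :
    ∑ i ∈ Finset.range (N * q), g (i : ZMod N) = q • ∑ u : ZMod N, g u := by
  induction q with
  | zero => simp
  | succ q ih =>
    rw [Nat.mul_succ, Finset.sum_range_add, ih, succ_nsmul]
    congr 1
    refine Finset.sum_nbij' (fun i => (i : ZMod N)) (fun u => u.val) ?_ ?_ ?_ ?_ ?_
    · simp
    · intro u _
      simpa using ZMod.val_lt u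
    · intro i hi
      exact ZMod.val_cast_of_lt (Finset.mem_range.1 hi)
    · intro u _
      simp
    · intro i _
      simp

lemma jac_sum_zero (N : ℕ) [NeZero N] (h2 : IsUnit (2 : ZMod N)) (h3 : IsUnit (3 : ZMod N)) :
    ∑ u : ZMod N, (Ring.inverse u) ^ 2 = 0 := by
  have h : ∑ u : ZMod N, (Ring.inverse (2 * u)) ^ 2 = ∑ u : ZMod N, (Ring.inverse u) ^ 2 := by
    obtain ⟨v, hv⟩ := h2
    rw [← hv]
    exact Fintype.sum_equiv (Units.mulLeft v) _ _ (fun u => rfl)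
  have hm : ∀ u : ZMod N, (Ring.inverse (2 * u)) ^ 2 
      = (Ring.inverse (2 : ZMod N)) ^ 2 * (Ring.inverse u) ^ 2 := by
    intro u
    rw [Ring.mul_inverse_rev]
    ring
  simp_rw [hm] at h
  rw [← Finset.mul_sum] at h
  have hu := Ring.mul_inverse_cancel _ h2
  apply h3.mul_left_cancel
  generalize (∑ u : ZMod N, (Ring.inverse u) ^ 2) = S at *
  generalize Ring.inverse (2 : ZMod N) = w at *
  linear_combination (-4) * h + (2 * w + 1) * S * hu

lemma jac_main (p : ℕ) (hp : p.Prime) (hp3 : 3 < p) (b k : ℕ) (hb : p ^ b ∣ k) (t : ℤ) :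
    ∃ e r : ℤ, ∏ i ∈ jacS p k, (((p * k - i : ℕ) : ℤ) * (i : ℤ) + t)
      = ∏ i ∈ jacS p k, (((p * k - i : ℕ) : ℤ) * (i : ℤ)) + t * ((p : ℤ) ^ (b + 1) * e)
        + t ^ 2 * r := by
  set N := p ^ (b + 1) with hN
  have : NeZero N := ⟨pow_ne_zero _ hp.ne_zero⟩
  obtain ⟨q, rfl⟩ := hb
  have hpk : p * (p ^ b * q) = N * q := by rw [hN]; ring
  have hunit : ∀ i : ℕ, IsUnit (i : ZMod N) ↔ ¬ p ∣ i := by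
    intro i
    rw [ZMod.isUnit_iff_coprime, hN, Nat.coprime_pow_right_iff (by omega), Nat.coprime_comm,
      hp.coprime_iff_not_dvd]
  have hcast : ∀ i ∈ jacS p (p ^ b * q),
      (((((p * (p ^ b * q) - i : ℕ) : ℤ) * (i : ℤ) : ℤ)) : ZMod N) = - (i : ZMod N) ^ 2 := by
    intro i hi
    simp only [jacS, Finset.mem_filter, Finset.mem_range] at hi
    rw [hpk] at hi ⊢
    rw [Nat.cast_sub hi.1.le]
    push_cast
    simp
    ring
  obtain ⟨e, r, h1, h2⟩ := jac_expand (N := N) (jacS p (p ^ b * q))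
    (fun i => ((p * (p ^ b * q) - i : ℕ) : ℤ) * (i : ℤ)) t (by
      intro i hi
      rw [hcast i hi]
      simp only [jacS, Finset.mem_filter] at hi
      exact (((hunit i).2 hi.2).pow 2).neg)
  have hs : ∑ i ∈ jacS p (p ^ b * q), Ring.inverse
      (((((p * (p ^ b * q) - i : ℕ) : ℤ) * (i : ℤ) : ℤ)) : ZMod N) = 0 := by
    have e1 : ∀ i ∈ jacS p (p ^ b * q), Ring.inverse
      (((((p * (p ^ b * q) - i : ℕ) : ℤ) * (i : ℤ) : ℤ)) : ZMod N)
        = - (Ring.inverse (i : ZMod N)) ^ 2 := by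
      intro i hi
      have hi2 := hi
      simp only [jacS, Finset.mem_filter] at hi2
      obtain ⟨u, hu⟩ := (hunit i).2 hi2.2
      rw [hcast i hi, ← hu, ← Units.val_pow_eq_pow_val, ← Units.val_neg, Ring.inverse_unit,
        Ring.inverse_unit, inv_neg, Units.val_neg, ← inv_pow, Units.val_pow_eq_pow_val]
    rw [Finset.sum_congr rfl e1, Finset.sum_neg_distrib, neg_eq_zero]
    have e2 : ∑ i ∈ jacS p (p ^ b * q), (Ring.inverse (i : ZMod N)) ^ 2
        = ∑ i ∈ Finset.range (p * (p ^ b * q)), (Ring.inverse (i : ZMod N)) ^ 2 := by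
      apply Finset.sum_subset (Finset.filter_subset _ _)
      intro i hi hni
      have hd : p ∣ i := by
        by_contra hd
        exact hni (Finset.mem_filter.2 ⟨hi, hd⟩)
      rw [Ring.inverse_non_unit _ (fun h => (hunit i).1 h hd)]
      simp
    rw [e2, hpk, jac_sum_period N q (fun u => (Ring.inverse u) ^ 2), jac_sum_zero, smul_zero]
    · exact_mod_cast (hunit 2).2 (Nat.not_dvd_of_pos_of_lt (by omega) (by omega))
    · exact_mod_cast (hunit 3).2 (Nat.not_dvd_of_pos_of_lt (by omega) (by omega))
  rw [hs, mul_zero, ZMod.intCast_zmod_eq_zero_iff_dvd] at h2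
  obtain ⟨e', rfl⟩ := h2
  refine ⟨e', r, ?_⟩
  rw [h1, hN]
  push_cast
  ring

theorem binom_pn_pk_pow_congruence (p : ℕ) (hp : p.Prime) (hp3 : 3 < p)
    (n : ℕ) (hn : 0 < n) (k : ℕ) (hk : k ≤ n) :
    ((p : ℤ) ^ (3 + 3 * padicValNat p n) ∣
        (Nat.choose (p * n) (p * k) : ℤ) ^ 2 - (Nat.choose n k : ℤ) ^ 2) ∧
    ((p : ℤ) ^ (3 + 3 * padicValNat p n) ∣
        (Nat.choose (p * n) (p * k) : ℤ) ^ 3 - (Nat.choose n k : ℤ) ^ 3) := by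
  rcases Nat.eq_zero_or_pos k with rfl | hk0
  · simp
  have := Fact.mk hp
  have hpZ : Prime (p : ℤ) := Nat.prime_iff_prime_int.1 hp
  obtain ⟨n', hn'⟩ : p ^ padicValNat p n ∣ n := pow_padicValNat_dvd
  obtain ⟨k', hk'⟩ : p ^ padicValNat p k ∣ k := pow_padicValNat_dvd
  have hk'p : ¬ p ∣ k' := by
    intro h
    apply pow_succ_padicValNat_not_dvd (p := p) hk0.ne'
    rw [pow_succ]
    conv_rhs => rw [hk']
    exact Nat.mul_dvd_mul_left _ h
  generalize padicValNat p n = a at *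
  generalize padicValNat p k = b at *
  obtain ⟨c, hc⟩ : ∃ c, c = min a b := ⟨_, rfl⟩
  have hca : c ≤ a := by omega
  have hcb : c ≤ b := by omega
  -- valuation of the binomial
  have hC : (p : ℤ) ^ (a - c) ∣ (n.choose k : ℤ) := by
    rcases le_total a b with h | h
    · have : a - c = 0 := by omega
      rw [this]; simp
    · have hcb' : c = b := by omega
      obtain ⟨d, hd⟩ : ∃ d, a = b + d := ⟨a - b, by omega⟩
      have hh : p ^ d ∣ n.choose k := by
        obtain ⟨m, rfl⟩ : ∃ m, n = m + 1 := ⟨n - 1, by omega⟩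
        obtain ⟨l, rfl⟩ : ∃ l, k = l + 1 := ⟨k - 1, by omega⟩
        have h1 := Nat.add_one_mul_choose_eq m l
        rw [hd, pow_add] at hn'
        have h2 : k' * (m + 1).choose (l + 1) = p ^ d * (n' * m.choose l) := by
          have h3 : 0 < p ^ b := pow_pos hp.pos _
          apply Nat.eq_of_mul_eq_mul_left h3
          calc p ^ b * (k' * (m + 1).choose (l + 1))
              = (m + 1).choose (l + 1) * (p ^ b * k') := by ring
            _ = (m + 1) * m.choose l := by rw [← hk', h1]
            _ = _ := by rw [hn']; ring
        refine Nat.Coprime.dvd_of_dvd_mul_left ?_ (Dvd.intro _ h2.symm)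
        exact Nat.Coprime.pow_left _ ((hp.coprime_iff_not_dvd).2 hk'p)
      have : a - c = d := by omega
      rw [this]
      exact_mod_cast hh
  set A : ℤ := ((p * n).choose (p * k) : ℤ) with hA
  set C : ℤ := (n.choose k : ℤ) with hCdef
  set P : ℤ := ∏ i ∈ jacS p k, ((p * k - i : ℕ) : ℤ) with hP
  set Q : ℤ := ∏ i ∈ jacS p k, ((p * n - i : ℕ) : ℤ) with hQ
  have hAP : A * P = C * Q := by
    have := jac_choose p n k hp.pos
    rw [hA, hP, hCdef, hQ]
    exact_mod_cast this
  have hle : p * k ≤ p * n := Nat.mul_le_mul_left p hk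
  have hmem : ∀ i ∈ jacS p k, i < p * k ∧ ¬ p ∣ i := by
    intro i hi
    simpa [jacS] using hi
  have hP' : P = ∏ i ∈ jacS p k, (i : ℤ) := by
    rw [hP]; exact jac_reflect p k (fun i => (i : ℤ))
  have hQ' : Q = ∏ i ∈ jacS p k, ((i : ℤ) + p * (n - k)) := by
    rw [hQ, ← jac_reflect p k (fun i => ((p * n - i : ℕ) : ℤ))]
    refine Finset.prod_congr rfl fun i hi => ?_
    have := (hmem i hi).1
    rw [Nat.cast_sub (by omega), Nat.cast_sub (by omega)]
    push_cast
    ring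
  have hPu : ¬ (p : ℤ) ∣ P := by
    rw [hP', hpZ.dvd_finsetProd_iff]
    rintro ⟨i, hi, h⟩
    exact (hmem i hi).2 (by exact_mod_cast h)
  have hQP : (p : ℤ) ∣ Q - P := by
    rw [hQ', hP', ← Int.modEq_iff_dvd, ← ZMod.intCast_eq_intCast_iff]
    push_cast
    simp
  obtain ⟨e, r, hmain⟩ := jac_main p hp hp3 b k ⟨k', hk'⟩ ((p : ℤ) ^ 2 * n * (n - k))
  have hPP : ∏ i ∈ jacS p k, (((p * k - i : ℕ) : ℤ) * (i : ℤ)) = P ^ 2 := by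
    rw [Finset.prod_mul_distrib, ← hP', ← hP, sq]
  have hQQ : ∏ i ∈ jacS p k, (((p * k - i : ℕ) : ℤ) * (i : ℤ) + (p : ℤ) ^ 2 * n * (n - k))
      = Q ^ 2 := by
    rw [sq Q]
    nth_rewrite 1 [hQ']
    rw [hQ, ← Finset.prod_mul_distrib]
    refine Finset.prod_congr rfl fun i hi => ?_
    have := (hmem i hi).1
    rw [Nat.cast_sub (by omega), Nat.cast_sub (by omega)]
    push_cast
    ring
  rw [hPP, hQQ] at hmain
  have hnk : (p : ℤ) ^ c ∣ (n : ℤ) - k := by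
    apply dvd_sub
    · rw [hn']; push_cast
      exact (pow_dvd_pow _ hca).mul_right _
    · rw [hk']; push_cast
      exact (pow_dvd_pow _ hcb).mul_right _
  obtain ⟨w, hw⟩ := hnk
  obtain ⟨a', ha'⟩ : ∃ a', a = c + a' := ⟨a - c, by omega⟩
  obtain ⟨b', hb'⟩ : ∃ b', b = c + b' := ⟨b - c, by omega⟩
  have hac : a - c = a' := by omega
  rw [hac] at hC
  have hnZ : (n : ℤ) = p ^ a * n' := by exact_mod_cast hn'
  have hE : (p : ℤ) ^ (3 + a + 2 * c) ∣ Q ^ 2 - P ^ 2 := by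
    rw [hmain, hw, hnZ]
    refine ⟨n' * w * p ^ b' * e + p ^ (1 + a) * n' ^ 2 * w ^ 2 * r, ?_⟩
    rw [hb']
    ring
  have hcop : ∀ m j : ℕ, IsCoprime ((p : ℤ) ^ m) (P ^ j) := fun m j =>
    ((hpZ.coprime_iff_not_dvd).2 hPu).pow
  have hE1 : (p : ℤ) ^ (3 + a + 2 * c) ∣ Q - P := by
    have hsum : ¬ (p : ℤ) ∣ Q + P := by
      intro h
      have h2 : (p : ℤ) ∣ 2 * P := by
        have := dvd_sub h hQP
        ring_nf at this ⊢
        exact this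
      rcases hpZ.dvd_or_dvd h2 with h | h
      · have := Int.le_of_dvd (by norm_num) h
        omega
      · exact hPu h
    have hc2 : IsCoprime ((p : ℤ) ^ (3 + a + 2 * c)) (Q + P) :=
      ((hpZ.coprime_iff_not_dvd).2 hsum).pow_left
    apply hc2.dvd_of_dvd_mul_left
    have : (Q + P) * (Q - P) = Q ^ 2 - P ^ 2 := by ring
    rwa [this]
  constructor
  · apply (hcop _ 2).dvd_of_dvd_mul_left
    have h1 : P ^ 2 * (A ^ 2 - C ^ 2) = C ^ 2 * (Q ^ 2 - P ^ 2) := by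
      linear_combination (A * P + C * Q) * hAP
    rw [h1]
    have h2 : 3 + 3 * a = a' * 2 + (3 + a + 2 * c) := by omega
    rw [h2, pow_add, pow_mul]
    exact mul_dvd_mul (pow_dvd_pow_of_dvd hC 2) hE
  · apply (hcop _ 3).dvd_of_dvd_mul_left
    have h1 : P ^ 3 * (A ^ 3 - C ^ 3) = C ^ 3 * ((Q - P) * (Q ^ 2 + Q * P + P ^ 2)) := by
      linear_combination ((A * P) ^ 2 + A * P * (C * Q) + (C * Q) ^ 2) * hAP
    rw [h1]
    have h2 : 3 + 3 * a ≤ a' * 3 + (3 + a + 2 * c) := by omega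
    refine (pow_dvd_pow _ h2).trans ?_
    rw [pow_add, pow_mul]
    exact mul_dvd_mul (pow_dvd_pow_of_dvd hC 3) (hE1.mul_right _)
end
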